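/- arXiv:1304.3595 — 4 statements merged into one kernel-verified Lean document; each statement's English description precedes it below -/
import Mathlib

section
/- Let λ ∈ ℝ and let g : ℝ → ℝ be a smooth function with g'(x) > 0 for all x satisfying the eigenvalue equation −L g = λ g on ℝ. Then, choosing a := 1/g', the potential V_a is identically equal to λ, i.e. V_a(x) = λ for every x ∈ ℝ. (This shows the supremum in the Chen–Wang formula is attained when the spectral gap is an eigenvalue with monotone eigenfunction.) -/
/-- The Sturm–Liouville operator `L f = σ² f'' + b f'`. -/
noncomputable def Lop (σ b f : ℝ → ℝ) : ℝ → ℝ :=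
  fun x => σ x ^ 2 * deriv (deriv f) x + b x * deriv f x

/-- The drift `b_a = 2σσ' + b − 2σ² a'/a` of the dual operator `L_a`. -/
noncomputable def driftA (σ b a : ℝ → ℝ) : ℝ → ℝ :=
  fun x => 2 * σ x * deriv σ x + b x - 2 * σ x ^ 2 * deriv a x / a x

/-- The Feynman–Kac potential `V_a = L_a(a)/a − b'`. -/
noncomputable def potV (σ b a : ℝ → ℝ) : ℝ → ℝ :=
  fun x => Lop σ (driftA σ b a) a x / a x - deriv b x

/-- The derivative of `1 / u` for a nonvanishing differentiable function `u`. -/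
theorem deriv_one_div_eq {u : ℝ → ℝ} (hu : Differentiable ℝ u) (hu0 : ∀ x, u x ≠ 0) :
    deriv (fun y => 1 / u y) = fun y => -deriv u y / u y ^ 2 := by
  funext y
  simpa only [one_div] using ((hu y).hasDerivAt.fun_inv (hu0 y)).deriv

/-- The second derivative of `1 / u` for a nonvanishing twice differentiable function `u`. -/
theorem deriv_deriv_one_div_eq {u : ℝ → ℝ} (hu : Differentiable ℝ u)
    (hu' : Differentiable ℝ (deriv u)) (hu0 : ∀ x, u x ≠ 0) (x : ℝ) :
    deriv (deriv fun y => 1 / u y) x =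
      -deriv (deriv u) x / u x ^ 2 + 2 * deriv u x ^ 2 / u x ^ 3 := by
  have h0 := hu0 x
  rw [deriv_one_div_eq hu hu0,
    ((hu' x).hasDerivAt.fun_neg.fun_div ((hu x).hasDerivAt.fun_pow 2) (pow_ne_zero 2 h0)).deriv]
  field_simp
  ring

/-- The derivative of `L f`. -/
theorem hasDerivAt_Lop {σ b f : ℝ → ℝ} {x : ℝ} (hσ : DifferentiableAt ℝ σ x)
    (hb : DifferentiableAt ℝ b x) (hf' : DifferentiableAt ℝ (deriv f) x)
    (hf'' : DifferentiableAt ℝ (deriv (deriv f)) x) :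
    HasDerivAt (Lop σ b f)
      (2 * σ x * deriv σ x * deriv (deriv f) x + σ x ^ 2 * deriv (deriv (deriv f)) x +
        (deriv b x * deriv f x + b x * deriv (deriv f) x)) x := by
  have h := ((hσ.hasDerivAt.fun_pow 2).fun_mul hf''.hasDerivAt).fun_add
    (hb.hasDerivAt.fun_mul hf'.hasDerivAt)
  simp only [Nat.cast_ofNat, Nat.add_one_sub_one, pow_one] at h
  exact h

/-- If `−L g = λ g` with `g` smooth and strictly increasing (`g' > 0`), then choosing
`a := 1/g'` the potential `V_a` is identically equal to `λ`. -/
theorem potV_eq_eigenvalue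
    (σ b g : ℝ → ℝ) (lam : ℝ)
    (hσ : ContDiff ℝ (⊤ : ℕ∞) σ) (hb : ContDiff ℝ (⊤ : ℕ∞) b) (hg : ContDiff ℝ (⊤ : ℕ∞) g)
    (hσpos : ∀ x, 0 < σ x) (hg' : ∀ x, 0 < deriv g x)
    (heigen : ∀ x, - Lop σ b g x = lam * g x) :
    ∀ x : ℝ, potV σ b (fun y => 1 / deriv g y) x = lam := by
  have hg₁ : ContDiff ℝ (⊤ : ℕ∞) (deriv g) := (contDiff_infty_iff_deriv.1 hg).2
  have hg₂ : ContDiff ℝ (⊤ : ℕ∞) (deriv (deriv g)) := (contDiff_infty_iff_deriv.1 hg₁).2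
  have dg := (contDiff_infty_iff_deriv.1 hg).1
  have dg₁ := (contDiff_infty_iff_deriv.1 hg₁).1
  have dg₂ := (contDiff_infty_iff_deriv.1 hg₂).1
  have dσ := (contDiff_infty_iff_deriv.1 hσ).1
  have db := (contDiff_infty_iff_deriv.1 hb).1
  have hu0 : ∀ x, deriv g x ≠ 0 := fun x => (hg' x).ne'
  intro x
  have h0 := hu0 x
  have hL : Lop σ b g = fun y => -(lam * g y) := funext fun y => by linarith [heigen y]
  have key := hasDerivAt_Lop (dσ x) (db x) (dg₁ x) (dg₂ x)
  rw [hL] at key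
  have key' := key.unique ((dg x).hasDerivAt.const_mul lam).fun_neg
  simp only [potV, driftA, Lop]
  rw [deriv_deriv_one_div_eq dg₁ dg₂ hu0 x, deriv_one_div_eq dg₁ hu0]
  field_simp
  linear_combination -deriv g x * key'
end

section
/- For every smooth positive function h : ℝ → ℝ, every smooth V : ℝ → ℝ and every smooth f : ℝ → ℝ, Doob's h-transform of the Schrödinger operator L − V satisfies pointwise (L(hf) − V·hf)/h = σ² f'' + (b + 2σ² h'/h) f' + (L h/h − V) f. In particular, taking h := σ/a and V := V_σ = Lσ/σ − b', one has the identity (L(hf) − V_σ·hf)/h = L_a f − V_a f, i.e. the (σ/a)-transform of L − V_σ equals L_a − V_a. -/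
theorem deriv_mul_of_contDiff {f g : ℝ → ℝ} (hf : ContDiff ℝ (⊤ : ℕ∞) f)
    (hg : ContDiff ℝ (⊤ : ℕ∞) g) :
    deriv (fun y => f y * g y) = fun y => deriv f y * g y + f y * deriv g y := by
  funext y
  exact deriv_fun_mul (hf.differentiable (by simp) y) (hg.differentiable (by simp) y)

theorem deriv_deriv_mul_of_contDiff {f g : ℝ → ℝ} (hf : ContDiff ℝ (⊤ : ℕ∞) f)
    (hg : ContDiff ℝ (⊤ : ℕ∞) g) (x : ℝ) :
    deriv (deriv (fun y => f y * g y)) x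
      = deriv (deriv f) x * g x + 2 * (deriv f x * deriv g x) + f x * deriv (deriv g) x := by
  have hf' : ContDiff ℝ (⊤ : ℕ∞) (deriv f) := (contDiff_infty_iff_deriv.mp hf).2
  have hg' : ContDiff ℝ (⊤ : ℕ∞) (deriv g) := (contDiff_infty_iff_deriv.mp hg).2
  have h₁ := (hf'.mul hg).differentiable (by simp) x
  have h₂ := (hf.mul hg').differentiable (by simp) x
  rw [deriv_mul_of_contDiff hf hg, deriv_fun_add h₁ h₂, deriv_mul_of_contDiff hf' hg,
    deriv_mul_of_contDiff hf hg']
  ring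

/-- The product rule for `L`: `L (f g) = (L f) g + 2 σ² f' g' + f (L g)`. -/
theorem Lop_mul (σ b : ℝ → ℝ) {f g : ℝ → ℝ} (hf : ContDiff ℝ (⊤ : ℕ∞) f)
    (hg : ContDiff ℝ (⊤ : ℕ∞) g) (x : ℝ) :
    Lop σ b (fun y => f y * g y) x
      = Lop σ b f x * g x + 2 * σ x ^ 2 * (deriv f x * deriv g x) + f x * Lop σ b g x := by
  simp only [Lop]
  rw [deriv_deriv_mul_of_contDiff hf hg, deriv_mul_of_contDiff hf hg]
  ring

/-- Doob's `h`-transform of the Schrödinger operator `L − V`: the general formula, and in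
particular with `h := σ/a` and `V := V_σ` it yields the dual Schrödinger operator
`L_a − V_a`. -/
theorem doob_h_transform
    (σ b a h V f : ℝ → ℝ)
    (hσ : ContDiff ℝ (⊤ : ℕ∞) σ) (hb : ContDiff ℝ (⊤ : ℕ∞) b) (ha : ContDiff ℝ (⊤ : ℕ∞) a)
    (hh : ContDiff ℝ (⊤ : ℕ∞) h) (hV : ContDiff ℝ (⊤ : ℕ∞) V) (hf : ContDiff ℝ (⊤ : ℕ∞) f)
    (hσpos : ∀ x, 0 < σ x) (hapos : ∀ x, 0 < a x) (hhpos : ∀ x, 0 < h x) :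
    (∀ x : ℝ,
      (Lop σ b (fun y => h y * f y) x - V x * (h x * f x)) / h x
        = σ x ^ 2 * deriv (deriv f) x
            + (b x + 2 * σ x ^ 2 * deriv h x / h x) * deriv f x
            + (Lop σ b h x / h x - V x) * f x)
    ∧ (∀ x : ℝ,
      (Lop σ b (fun y => (σ y / a y) * f y) x
          - potV σ b σ x * ((σ x / a x) * f x)) / (σ x / a x)
        = Lop σ (driftA σ b a) f x - potV σ b a x * f x) := by
  refine ⟨fun x => ?_, fun x => ?_⟩
  · have hx := (hhpos x).ne'
    rw [Lop_mul σ b hh hf]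
    simp only [Lop]
    field_simp
    ring
  · obtain ⟨k, hk⟩ : ∃ k : ℝ → ℝ, k = fun y => σ y / a y := ⟨_, rfl⟩
    have hkC : ContDiff ℝ (⊤ : ℕ∞) k := hk ▸ hσ.div ha fun y => (hapos y).ne'
    have hkx : k x ≠ 0 := by
      rw [hk]
      exact (div_pos (hσpos x) (hapos x)).ne'
    have hax := (hapos x).ne'
    have hσk : σ = fun y => k y * a y := by
      funext y
      rw [hk]
      exact (div_mul_cancel₀ _ (hapos y).ne').symm
    have e₀ : σ x = k x * a x := congrFun hσk x
    have e₁ : deriv σ x = deriv k x * a x + k x * deriv a x := by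
      rw [hσk, deriv_mul_of_contDiff hkC ha]
    have e₂ : deriv (deriv σ) x
        = deriv (deriv k) x * a x + 2 * (deriv k x * deriv a x) + k x * deriv (deriv a) x := by
      rw [hσk, deriv_deriv_mul_of_contDiff hkC ha]
    have hkf : (fun y => σ y / a y * f y) = fun y => k y * f y := by rw [hk]
    have hkq : σ x / a x = k x := by rw [hk]
    rw [hkf, hkq, Lop_mul σ b hkC hf]
    simp only [Lop, potV, driftA]
    rw [e₂, e₁, e₀]
    field_simp
    ring
end

section
/- For every smooth f : ℝ → ℝ, the Bakry–Émery Γ₂ form of the operator L satisfies the pointwise identity Γ₂(f,f) = σ²·(σ f'' + σ' f')² + V_σ·Γ(f,f), where Γ(f,f) = σ²(f')² and V_σ = Lσ/σ − b'. Consequently, if V_σ(x) ≥ ρ for all x ∈ ℝ then Γ₂(f,f) ≥ ρ·Γ(f,f) pointwise. -/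
/-- The carré du champ `Γ(f,f) = σ² (f')²`. -/
noncomputable def gammaOp (σ f : ℝ → ℝ) : ℝ → ℝ := fun x => σ x ^ 2 * deriv f x ^ 2

/-- The Bakry–Émery form `Γ₂(f,f) = (L Γ(f,f) − 2 Γ(f, Lf))/2`. -/
noncomputable def gamma2Op (σ b f : ℝ → ℝ) : ℝ → ℝ :=
  fun x => (Lop σ b (gammaOp σ f) x
      - 2 * (σ x ^ 2 * deriv f x * deriv (Lop σ b f) x)) / 2

/-- Along the dual direction `a = σ` the dual drift is `b` itself. -/
theorem driftA_self {σ : ℝ → ℝ} (b : ℝ → ℝ) (hσ : ∀ x, σ x ≠ 0) : driftA σ b σ = b := by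
  funext x
  have := hσ x
  simp only [driftA]
  field_simp
  ring

theorem ContDiff.hasDerivAt_deriv {g : ℝ → ℝ} (hg : ContDiff ℝ (⊤ : ℕ∞) g) (x : ℝ) :
    HasDerivAt g (deriv g x) x :=
  (hg.differentiable (by simp) x).hasDerivAt

theorem ContDiff.deriv_top {g : ℝ → ℝ} (hg : ContDiff ℝ (⊤ : ℕ∞) g) :
    ContDiff ℝ (⊤ : ℕ∞) (deriv g) :=
  (contDiff_infty_iff_deriv.1 hg).2

theorem deriv_Lop {σ b f : ℝ → ℝ} (hσ : ContDiff ℝ (⊤ : ℕ∞) σ) (hb : ContDiff ℝ (⊤ : ℕ∞) b)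
    (hf : ContDiff ℝ (⊤ : ℕ∞) f) (x : ℝ) :
    deriv (Lop σ b f) x =
      2 * σ x * deriv σ x * deriv (deriv f) x + σ x ^ 2 * deriv (deriv (deriv f)) x
        + (deriv b x * deriv f x + b x * deriv (deriv f) x) := by
  have h := (((hσ.hasDerivAt_deriv x).pow 2).mul
    (hf.deriv_top.deriv_top.hasDerivAt_deriv x)).add
      ((hb.hasDerivAt_deriv x).mul (hf.deriv_top.hasDerivAt_deriv x))
  refine HasDerivAt.deriv (h.congr_deriv ?_)
  simp

theorem deriv_gammaOp {σ f : ℝ → ℝ} (hσ : ContDiff ℝ (⊤ : ℕ∞) σ)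
    (hf : ContDiff ℝ (⊤ : ℕ∞) f) :
    deriv (gammaOp σ f) = fun x =>
      2 * (σ x * deriv f x) * (deriv σ x * deriv f x + σ x * deriv (deriv f) x) := by
  funext x
  have h := ((hσ.hasDerivAt_deriv x).pow 2).mul ((hf.deriv_top.hasDerivAt_deriv x).pow 2)
  refine HasDerivAt.deriv (h.congr_deriv ?_)
  simp
  ring

theorem deriv_deriv_gammaOp {σ f : ℝ → ℝ} (hσ : ContDiff ℝ (⊤ : ℕ∞) σ)
    (hf : ContDiff ℝ (⊤ : ℕ∞) f) (x : ℝ) :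
    deriv (deriv (gammaOp σ f)) x =
      2 * (deriv σ x * deriv f x + σ x * deriv (deriv f) x) ^ 2
        + 2 * (σ x * deriv f x) * (deriv (deriv σ) x * deriv f x
          + 2 * deriv σ x * deriv (deriv f) x + σ x * deriv (deriv (deriv f)) x) := by
  rw [deriv_gammaOp hσ hf]
  have s0 := hσ.hasDerivAt_deriv x
  have s1 := hσ.deriv_top.hasDerivAt_deriv x
  have f1 := hf.deriv_top.hasDerivAt_deriv x
  have f2 := hf.deriv_top.deriv_top.hasDerivAt_deriv x
  have h := ((s0.mul f1).const_mul 2).mul ((s1.mul f1).add (s0.mul f2))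
  refine HasDerivAt.deriv (h.congr_deriv ?_)
  simp
  ring

/-- Pointwise identity `Γ₂(f,f) = σ²(σ f'' + σ' f')² + V_σ Γ(f,f)`, and the consequent
Bakry–Émery criterion: `V_σ ≥ ρ` implies `Γ₂(f,f) ≥ ρ Γ(f,f)`. -/
theorem gamma2_identity
    (σ b f : ℝ → ℝ)
    (hσ : ContDiff ℝ (⊤ : ℕ∞) σ) (hb : ContDiff ℝ (⊤ : ℕ∞) b) (hf : ContDiff ℝ (⊤ : ℕ∞) f)
    (hσpos : ∀ x, 0 < σ x) :
    (∀ x : ℝ,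
      gamma2Op σ b f x
        = σ x ^ 2 * (σ x * deriv (deriv f) x + deriv σ x * deriv f x) ^ 2
            + potV σ b σ x * gammaOp σ f x)
    ∧ (∀ ρ : ℝ, (∀ x, ρ ≤ potV σ b σ x) →
        ∀ x : ℝ, ρ * gammaOp σ f x ≤ gamma2Op σ b f x) := by
  have key : ∀ x : ℝ,
      gamma2Op σ b f x
        = σ x ^ 2 * (σ x * deriv (deriv f) x + deriv σ x * deriv f x) ^ 2
            + potV σ b σ x * gammaOp σ f x := by
    intro x
    have hx : σ x ≠ 0 := (hσpos x).ne'
    rw [potV, driftA_self b fun y => (hσpos y).ne', gamma2Op, deriv_Lop hσ hb hf, Lop,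
      deriv_deriv_gammaOp hσ hf, deriv_gammaOp hσ hf, Lop, gammaOp]
    field_simp
    ring
  refine ⟨key, fun ρ hρ x => ?_⟩
  have hΓ : 0 ≤ gammaOp σ f x := by unfold gammaOp; positivity
  rw [key x]
  exact (mul_le_mul_of_nonneg_right (hρ x) hΓ).trans (le_add_of_nonneg_left (by positivity))
end

section
/- (Restricted φ-entropy inequality.) Let I ⊂ ℝ be an open interval and let φ : I → ℝ be smooth with φ'' > 0, φ''' ≤ 0 and −1/φ'' convex on I. Suppose there exist a smooth positive function a : ℝ → ℝ, constants 0 < m ≤ M with m·σ ≤ a ≤ M·σ, and ρ > 0 with V_a(x) ≥ ρ for all x. Then for every smooth increasing function f : ℝ → I whose derivative is compactly supported and such that (σ/a)'(x) ≤ 0 for all x, one has 2ρ · Ent_μ^φ(f) ≤ ∫_ℝ σ(x)² φ''(f(x)) f'(x)² dμ(x), where Ent_μ^φ(f) := ∫ φ(f) dμ − φ(∫ f dμ). -/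
open MeasureTheory

/-- The potential `U(x) = U(0) − ∫_0^x b/σ²`. -/
noncomputable def Upot (σ b : ℝ → ℝ) (U0 : ℝ) : ℝ → ℝ :=
  fun x => U0 - ∫ u in (0:ℝ)..x, b u / σ u ^ 2

/-- The reversible measure `μ` with density `e^{−U}/σ²` w.r.t. Lebesgue measure. -/
noncomputable def muMeas (σ b : ℝ → ℝ) (U0 : ℝ) : Measure ℝ :=
  volume.withDensity (fun x => ENNReal.ofReal (Real.exp (-(Upot σ b U0 x)) / σ x ^ 2))

/-- The variance `Var_μ(f) = ∫ f² dμ − (∫ f dμ)²`. -/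
noncomputable def varMu (μ : Measure ℝ) (f : ℝ → ℝ) : ℝ :=
  (∫ x, f x ^ 2 ∂μ) - (∫ x, f x ∂μ) ^ 2

section Helpers

open Set Filter Topology

section ODE

variable {α β : ℝ}

/-- Truncation of a real number to `[-R, R]`. -/
noncomputable def clampReal (R t : ℝ) : ℝ := max (-R) (min t R)

lemma clampReal_of_abs_le {R t : ℝ} (h : |t| ≤ R) : clampReal R t = t := by
  rw [abs_le] at h
  simp [clampReal, h.1, h.2]

lemma abs_clampReal_le {R : ℝ} (hR : 0 ≤ R) (t : ℝ) : |clampReal R t| ≤ R := by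
  rw [abs_le, clampReal]
  exact ⟨le_max_left _ _, max_le (by linarith) (min_le_right _ _)⟩

lemma abs_clampReal_le_abs {R : ℝ} (hR : 0 ≤ R) (t : ℝ) : |clampReal R t| ≤ |t| := by
  rw [abs_le, clampReal]
  refine ⟨?_, max_le (by linarith [abs_nonneg t]) ((min_le_left _ _).trans (le_abs_self t))⟩
  rcases le_total t R with h | h
  · rw [min_eq_left h]; exact (neg_abs_le t).trans (le_max_right _ _)
  · rw [min_eq_right h]; exact (neg_nonpos.2 (abs_nonneg t)).trans (hR.trans (le_max_right _ _))

lemma abs_clampReal_sub_le (R s t : ℝ) : |clampReal R s - clampReal R t| ≤ |s - t| := by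
  refine (abs_max_sub_max_le_max _ _ _ _).trans ?_
  refine max_le (by simp) ((abs_min_sub_min_le_max _ _ _ _).trans (max_le le_rfl (by simp)))

/-- Global solvability of the initial value problem for `u' = P q`, `q' = Q (u - v)`. -/
lemma exists_linear_ivp (hαβ : α < β) {P Q v : ℝ → ℝ} (hP : ContinuousOn P (Icc α β))
    (hQ : ContinuousOn Q (Icc α β)) (hv : ContinuousOn v (Icc α β)) (u₀ q₀ : ℝ) :
    ∃ u q : ℝ → ℝ, u α = u₀ ∧ q α = q₀ ∧ ContinuousOn u (Icc α β) ∧ ContinuousOn q (Icc α β) ∧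
      (∀ x ∈ Ioo α β, HasDerivAt u (P x * q x) x) ∧
      (∀ x ∈ Ioo α β, HasDerivAt q (Q x * (u x - v x)) x) := by
  obtain ⟨K₁, hK₁⟩ := isCompact_Icc.exists_bound_of_continuousOn hP
  obtain ⟨K₂, hK₂⟩ := isCompact_Icc.exists_bound_of_continuousOn hQ
  obtain ⟨V, hV⟩ := isCompact_Icc.exists_bound_of_continuousOn hv
  set K : ℝ := max K₁ K₂
  have hα : α ∈ Icc α β := ⟨le_rfl, hαβ.le⟩
  have hPK : ∀ x ∈ Icc α β, |P x| ≤ K := fun x hx => (hK₁ x hx).trans (le_max_left _ _)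
  have hQK : ∀ x ∈ Icc α β, |Q x| ≤ K := fun x hx => (hK₂ x hx).trans (le_max_right _ _)
  have hK : 0 ≤ K := (abs_nonneg _).trans (hPK α hα)
  have hV0 : 0 ≤ V := (norm_nonneg _).trans (hV α hα)
  set z₀ : ℝ × ℝ := (u₀, q₀)
  set R : ℝ := gronwallBound ‖z₀‖ K (K * V) (β - α)
  have hmono := gronwallBound_mono (norm_nonneg z₀) (mul_nonneg hK hV0) hK
  have hR : 0 ≤ R := by
    refine (norm_nonneg z₀).trans ?_
    rw [← gronwallBound_x0 ‖z₀‖ K (K * V)]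
    exact hmono (by linarith)
  set F : ℝ → ℝ × ℝ → ℝ × ℝ :=
    fun t z => (P t * clampReal R z.2, Q t * (clampReal R z.1 - v t)) with hF
  set Λ : ℝ := K * (R + V)
  have hΛ : 0 ≤ Λ := by positivity
  have hbound : ∀ t ∈ Icc α β, ∀ z : ℝ × ℝ, ‖F t z‖ ≤ K * ‖z‖ + K * V := by
    intro t ht z
    have h1 : |clampReal R z.2| ≤ ‖z‖ := (abs_clampReal_le_abs hR _).trans (norm_snd_le z)
    have h2 : |clampReal R z.1| ≤ ‖z‖ := (abs_clampReal_le_abs hR _).trans (norm_fst_le z)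
    have h3 : |v t| ≤ V := hV t ht
    refine max_le ?_ ?_
    · simp only [hF, Real.norm_eq_abs, abs_mul]
      have := mul_le_mul (hPK t ht) h1 (abs_nonneg _) hK
      nlinarith [mul_nonneg hK hV0]
    · simp only [hF, Real.norm_eq_abs, abs_mul]
      have := mul_le_mul (hQK t ht) ((abs_sub _ _).trans (add_le_add h2 h3)) (abs_nonneg _) hK
      nlinarith
  have hPL : IsPicardLindelof F (tmin := α) (tmax := β) ⟨α, hα⟩ z₀
      (⟨Λ * (β - α), mul_nonneg hΛ (by linarith)⟩) 0 ⟨Λ, hΛ⟩ ⟨K, hK⟩ := by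
    refine ⟨?_, ?_, ?_, ?_⟩
    · intro t ht
      refine LipschitzOnWith.of_dist_le_mul fun x _ y _ => ?_
      simp only [hF, Prod.dist_eq, Real.dist_eq]
      refine max_le ?_ ?_
      · rw [← mul_sub, abs_mul]
        exact mul_le_mul (hPK t ht) ((abs_clampReal_sub_le _ _ _).trans (le_max_right _ _))
          (abs_nonneg _) hK
      · rw [← mul_sub, abs_mul, sub_sub_sub_cancel_right]
        exact mul_le_mul (hQK t ht) ((abs_clampReal_sub_le _ _ _).trans (le_max_left _ _))
          (abs_nonneg _) hK
    · intro z _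
      exact (hP.mul continuousOn_const).prodMk (hQ.mul (continuousOn_const.sub hv))
    · intro t ht z _
      refine max_le ?_ ?_
      · simp only [hF, Real.norm_eq_abs, abs_mul]
        refine mul_le_mul (hPK t ht) ?_ (abs_nonneg _) hK
        linarith [abs_clampReal_le hR z.2]
      · simp only [hF, Real.norm_eq_abs, abs_mul]
        refine mul_le_mul (hQK t ht) ?_ (abs_nonneg _) hK
        exact (abs_sub _ _).trans (add_le_add (abs_clampReal_le hR _) (hV t ht))
    · have h : max (β - α) (α - α) = β - α := max_eq_left (by linarith)
      change Λ * max (β - α) (α - α) ≤ Λ * (β - α) - 0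
      rw [h, sub_zero]
  obtain ⟨z, hz0, hz⟩ := hPL.exists_eq_forall_mem_Icc_hasDerivWithinAt₀
  have hzc : ContinuousOn z (Icc α β) := fun t ht => (hz t ht).continuousWithinAt
  have hzd : ∀ t ∈ Ioo α β, HasDerivAt z (F t (z t)) t := fun t ht =>
    (hz t (Ioo_subset_Icc_self ht)).hasDerivAt (Icc_mem_nhds ht.1 ht.2)
  have hzR : ∀ t ∈ Icc α β, ‖z t‖ ≤ R := by
    intro t ht
    refine (norm_le_gronwallBound_of_norm_deriv_right_le (f' := fun t => F t (z t)) hzc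
      (fun x hx => ?_) (δ := ‖z₀‖) (by rw [← hz0]) (fun x hx => ?_) t ht).trans
      (hmono (by linarith [ht.2]))
    · exact (hz x (Ico_subset_Icc_self hx)).mono_of_mem_nhdsWithin
        (mem_of_superset (Icc_mem_nhdsGE hx.2) (Icc_subset_Icc_left hx.1))
    · exact hbound x (Ico_subset_Icc_self hx) _
  refine ⟨fun t => (z t).1, fun t => (z t).2, ?_, ?_, hzc.fst, hzc.snd, fun x hx => ?_,
    fun x hx => ?_⟩
  · simpa using congrArg Prod.fst hz0
  · simpa using congrArg Prod.snd hz0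
  · have h : HasDerivAt (fun t => (z t).1) (F x (z x)).1 x := (hzd x hx).fst
    simp only [hF] at h
    rwa [clampReal_of_abs_le ((norm_snd_le (z x)).trans (hzR x (Ioo_subset_Icc_self hx)))] at h
  · have h : HasDerivAt (fun t => (z t).2) (F x (z x)).2 x := (hzd x hx).snd
    simp only [hF] at h
    rwa [clampReal_of_abs_le ((norm_fst_le (z x)).trans (hzR x (Ioo_subset_Icc_self hx)))] at h

/-- A function with nonnegative derivative and equal endpoint values has zero derivative. -/
lemma deriv_eq_zero_of_nonneg_of_endpoints_eq {N N' : ℝ → ℝ} (hc : ContinuousOn N (Icc α β))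
    (hd : ∀ x ∈ Ioo α β, HasDerivAt N (N' x) x) (h0 : ∀ x ∈ Ioo α β, 0 ≤ N' x)
    (he : N α = N β) : ∀ x ∈ Ioo α β, N' x = 0 := by
  intro x hx
  have hαβ : α ≤ β := (hx.1.trans hx.2).le
  have hmono : MonotoneOn N (Icc α β) := by
    refine monotoneOn_of_deriv_nonneg (convex_Icc _ _) hc ?_ ?_ <;> rw [interior_Icc]
    · exact fun y hy => (hd y hy).differentiableAt.differentiableWithinAt
    · exact fun y hy => by rw [(hd y hy).deriv]; exact h0 y hy
  have hconst : N =ᶠ[𝓝 x] fun _ => N α := by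
    filter_upwards [Icc_mem_nhds hx.1 hx.2] with y hy
    exact le_antisymm ((hmono hy ⟨hαβ, le_rfl⟩ hy.2).trans he.ge) (hmono ⟨le_rfl, hαβ⟩ hy hy.1)
  exact (hd x hx).unique ((hasDerivAt_const x (N α)).congr_of_eventuallyEq hconst)

lemma hasDerivAt_posPart_sq (t : ℝ) :
    HasDerivAt (fun t : ℝ => max t 0 ^ 2) (2 * max t 0) t := by
  rcases lt_trichotomy t 0 with h | rfl | h
  · rw [max_eq_right h.le, mul_zero]
    refine (hasDerivAt_const t (0 : ℝ)).congr_of_eventuallyEq ?_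
    filter_upwards [Iio_mem_nhds h] with y hy
    simp [max_eq_right (mem_Iio.1 hy).le]
  · rw [hasDerivAt_iff_isLittleO]
    have : (fun x : ℝ => max x 0 ^ 2) =O[𝓝 0] fun x => x ^ 2 := by
      refine Asymptotics.IsBigO.of_bound 1 (Eventually.of_forall fun x => ?_)
      rcases le_total x 0 with h | h <;> simp [h, sq_nonneg]
    simpa using this.trans_isLittleO (Asymptotics.isLittleO_pow_id one_lt_two)
  · rw [max_eq_left h.le]
    refine (by simpa using hasDerivAt_pow 2 t :
      HasDerivAt (fun t : ℝ => t ^ 2) (2 * t) t).congr_of_eventuallyEq ?_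
    filter_upwards [Ioi_mem_nhds h] with y hy
    simp [max_eq_left (mem_Ioi.1 hy).le]

lemma forall_Icc_of_forall_Ioo (hαβ : α < β) {f : ℝ → ℝ} {C : ℝ} (hf : ContinuousOn f (Icc α β))
    (h : ∀ x ∈ Ioo α β, f x ≤ C) : ∀ x ∈ Icc α β, f x ≤ C := by
  intro x hx
  have hx' : x ∈ closure (Ioo α β) := by rwa [closure_Ioo hαβ.ne]
  have : (𝓝[Ioo α β] x).NeBot := mem_closure_iff_nhdsWithin_neBot.1 hx'
  exact le_of_tendsto ((hf x hx).mono Ioo_subset_Icc_self)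
    (eventually_nhdsWithin_of_forall h)

/-- Maximum principle for the Neumann problem `u' = P q`, `q' = Q (u - v)`. -/
lemma neumann_le (hαβ : α < β) {P Q u q v : ℝ → ℝ} {C : ℝ}
    (hP : ∀ x ∈ Icc α β, 0 < P x) (hQ : ∀ x ∈ Icc α β, 0 < Q x)
    (hu : ContinuousOn u (Icc α β)) (hq : ContinuousOn q (Icc α β))
    (hud : ∀ x ∈ Ioo α β, HasDerivAt u (P x * q x) x)
    (hqd : ∀ x ∈ Ioo α β, HasDerivAt q (Q x * (u x - v x)) x)
    (hqα : q α = 0) (hqβ : q β = 0) (hv : ∀ x ∈ Icc α β, v x ≤ C) :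
    ∀ x ∈ Icc α β, u x ≤ C := by
  refine forall_Icc_of_forall_Ioo hαβ hu fun x hx => ?_
  have key := deriv_eq_zero_of_nonneg_of_endpoints_eq (α := α) (β := β)
    (N := fun x => max (u x - C) 0 ^ 2 * q x)
    (N' := fun x => 2 * max (u x - C) 0 * (P x * q x) * q x
      + max (u x - C) 0 ^ 2 * (Q x * (u x - v x)))
    ((((hu.sub continuousOn_const).sup continuousOn_const).pow 2).mul hq)
    (fun y hy => ((hasDerivAt_posPart_sq (u y - C)).comp y ((hud y hy).sub_const C)).mul (hqd y hy))
    (fun y hy => ?_) (by simp [hqα, hqβ]) x hx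
  · by_contra! hC
    have hx' := Ioo_subset_Icc_self hx
    rw [max_eq_left (by linarith)] at key
    have h1 : 0 ≤ 2 * (u x - C) * (P x * q x) * q x := by
      have : 0 ≤ 2 * (u x - C) * P x * (q x) ^ 2 :=
        mul_nonneg (mul_nonneg (by linarith) (hP x hx').le) (sq_nonneg _)
      linarith
    have h2 : 0 < (u x - C) ^ 2 * (Q x * (u x - v x)) :=
      mul_pos (pow_pos (by linarith) 2) (mul_pos (hQ x hx') (by linarith [hv x hx']))
    linarith
  · have hy' := Ioo_subset_Icc_self hy
    rcases le_total (u y - C) 0 with h | h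
    · simp [max_eq_right h]
    · simp only [max_eq_left h]
      have h1 : 0 ≤ 2 * (u y - C) * P y * (q y) ^ 2 :=
        mul_nonneg (mul_nonneg (by linarith) (hP y hy').le) (sq_nonneg _)
      have h2 : 0 ≤ (u y - C) ^ 2 * (Q y * (u y - v y)) :=
        mul_nonneg (sq_nonneg _) (mul_nonneg (hQ y hy').le (by linarith [hv y hy']))
      linarith

lemma neumann_abs_le (hαβ : α < β) {P Q u q v : ℝ → ℝ} {C : ℝ}
    (hP : ∀ x ∈ Icc α β, 0 < P x) (hQ : ∀ x ∈ Icc α β, 0 < Q x)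
    (hu : ContinuousOn u (Icc α β)) (hq : ContinuousOn q (Icc α β))
    (hud : ∀ x ∈ Ioo α β, HasDerivAt u (P x * q x) x)
    (hqd : ∀ x ∈ Ioo α β, HasDerivAt q (Q x * (u x - v x)) x)
    (hqα : q α = 0) (hqβ : q β = 0) (hv : ∀ x ∈ Icc α β, |v x| ≤ C) :
    ∀ x ∈ Icc α β, |u x| ≤ C := by
  intro x hx
  refine abs_le'.2 ⟨neumann_le hαβ hP hQ hu hq hud hqd hqα hqβ
    (fun y hy => (le_abs_self _).trans (hv y hy)) x hx, ?_⟩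
  refine neumann_le hαβ hP hQ (u := fun x => -u x) (q := fun x => -q x) (v := fun x => -v x)
    hu.neg hq.neg (fun y hy => ?_) (fun y hy => ?_) (by simp [hqα]) (by simp [hqβ])
    (fun y hy => (neg_le_abs _).trans (hv y hy)) x hx
  · convert! (hud y hy).neg using 1; ring
  · convert! (hqd y hy).neg using 1; ring

/-- The Neumann problem with monotone data has a nonnegative flux. -/
lemma neumann_flux_nonneg (hαβ : α < β) {P Q u q v v' : ℝ → ℝ}
    (hP : ∀ x ∈ Icc α β, 0 < P x) (hQ : ∀ x ∈ Icc α β, 0 < Q x)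
    (hu : ContinuousOn u (Icc α β)) (hq : ContinuousOn q (Icc α β))
    (hv : ContinuousOn v (Icc α β))
    (hud : ∀ x ∈ Ioo α β, HasDerivAt u (P x * q x) x)
    (hqd : ∀ x ∈ Ioo α β, HasDerivAt q (Q x * (u x - v x)) x)
    (hvd : ∀ x ∈ Ioo α β, HasDerivAt v (v' x) x)
    (hqα : q α = 0) (hqβ : q β = 0) (hv0 : ∀ x ∈ Icc α β, 0 ≤ v' x) :
    ∀ x ∈ Icc α β, 0 ≤ q x := by
  suffices h : ∀ x ∈ Icc α β, -q x ≤ 0 from fun x hx => by linarith [h x hx]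
  refine forall_Icc_of_forall_Ioo hαβ hq.neg fun x hx => ?_
  have key := deriv_eq_zero_of_nonneg_of_endpoints_eq (α := α) (β := β)
    (N := fun x => max (-q x) 0 ^ 2 * (v x - u x))
    (N' := fun x => 2 * max (-q x) 0 * (-(Q x * (u x - v x))) * (v x - u x)
      + max (-q x) 0 ^ 2 * (v' x - P x * q x))
    (((hq.neg.sup continuousOn_const).pow 2).mul (hv.sub hu))
    (fun y hy => ((hasDerivAt_posPart_sq (-q y)).comp y (hqd y hy).neg).mul
      ((hvd y hy).sub (hud y hy)))
    (fun y hy => ?_) (by simp [hqα, hqβ]) x hx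
  · by_contra! hC
    have hx' := Ioo_subset_Icc_self hx
    rw [max_eq_left (by linarith)] at key
    have h1 : 0 ≤ 2 * (-q x) * Q x * (u x - v x) ^ 2 :=
      mul_nonneg (mul_nonneg (by linarith) (hQ x hx').le) (sq_nonneg _)
    have h2 : 0 < (-q x) ^ 2 * (P x * (-q x)) :=
      mul_pos (pow_pos hC 2) (mul_pos (hP x hx') hC)
    have h3 : 0 ≤ (-q x) ^ 2 * v' x := mul_nonneg (sq_nonneg _) (hv0 x hx')
    linarith
  · have hy' := Ioo_subset_Icc_self hy
    rcases le_total (-q y) 0 with h | h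
    · simp [max_eq_right h]
    · simp only [max_eq_left h]
      have h1 : 0 ≤ 2 * (-q y) * Q y * (u y - v y) ^ 2 :=
        mul_nonneg (mul_nonneg (by linarith) (hQ y hy').le) (sq_nonneg _)
      have h2 : 0 ≤ (-q y) ^ 2 * (P y * (-q y)) :=
        mul_nonneg (sq_nonneg _) (mul_nonneg (hP y hy').le h)
      have h3 : 0 ≤ (-q y) ^ 2 * v' y := mul_nonneg (sq_nonneg _) (hv0 y hy')
      linarith

/-- Solvability of the Neumann problem `u' = P q`, `q' = Q (u - v)`, `q α = q β = 0`. -/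
lemma exists_neumann (hαβ : α < β) {P Q v : ℝ → ℝ} (hPc : ContinuousOn P (Icc α β))
    (hQc : ContinuousOn Q (Icc α β)) (hv : ContinuousOn v (Icc α β))
    (hP : ∀ x ∈ Icc α β, 0 < P x) (hQ : ∀ x ∈ Icc α β, 0 < Q x) :
    ∃ u q : ℝ → ℝ, q α = 0 ∧ q β = 0 ∧ ContinuousOn u (Icc α β) ∧ ContinuousOn q (Icc α β) ∧
      (∀ x ∈ Ioo α β, HasDerivAt u (P x * q x) x) ∧
      (∀ x ∈ Ioo α β, HasDerivAt q (Q x * (u x - v x)) x) := by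
  obtain ⟨u₁, q₁, -, hq₁, hu₁c, hq₁c, hu₁d, hq₁d⟩ := exists_linear_ivp hαβ hPc hQc hv 0 0
  obtain ⟨u₂, q₂, hu₂, hq₂, hu₂c, hq₂c, hu₂d, hq₂d⟩ :=
    exists_linear_ivp hαβ hPc hQc (v := fun _ => 0) continuousOn_const 1 0
  have hne : q₂ β ≠ 0 := by
    intro h0
    have := neumann_le hαβ hP hQ hu₂c hq₂c hu₂d hq₂d hq₂ h0 (fun _ _ => le_rfl) α
      ⟨le_rfl, hαβ.le⟩
    linarith
  set c := -q₁ β / q₂ β with hc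
  refine ⟨fun x => u₁ x + c * u₂ x, fun x => q₁ x + c * q₂ x, by simp [hq₁, hq₂], ?_,
    hu₁c.add (continuousOn_const.mul hu₂c), hq₁c.add (continuousOn_const.mul hq₂c),
    fun x hx => ?_, fun x hx => ?_⟩
  · simp only [hc]; field_simp; ring
  · convert! (hu₁d x hx).add ((hu₂d x hx).const_mul c) using 1; ring
  · convert! (hq₁d x hx).add ((hq₂d x hx).const_mul c) using 1; ring

end ODE

section Interval

/-- Coefficients of a Sturm–Liouville operator with speed density `w`, flux density `p` and
an intertwining weight `a`. -/
structure DiffusionCoeffs (ρ : ℝ) (σ b a p w : ℝ → ℝ) : Prop where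
  σ_smooth : ContDiff ℝ (⊤ : ℕ∞) σ
  b_smooth : ContDiff ℝ (⊤ : ℕ∞) b
  a_smooth : ContDiff ℝ (⊤ : ℕ∞) a
  σ_pos : ∀ x, 0 < σ x
  a_pos : ∀ x, 0 < a x
  p_pos : ∀ x, 0 < p x
  hasDerivAt_p : ∀ x, HasDerivAt p (p x * (b x / σ x ^ 2)) x
  w_eq : ∀ x, w x = p x / σ x ^ 2
  ρ_pos : 0 < ρ
  le_potV : ∀ x, ρ ≤ potV σ b a x
  deriv_div_le : ∀ x, deriv (fun y => σ y / a y) x ≤ 0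

/-- A convex function `φ` on `S` with successive derivatives `φ₁, ψ, ψ₁, ψ₂`, such that
`ψ₁ ≤ 0` and `-1/ψ` is convex. -/
structure EntropyFunction (S : Set ℝ) (φ φ₁ ψ ψ₁ ψ₂ : ℝ → ℝ) : Prop where
  hasDerivAt_φ : ∀ y ∈ S, HasDerivAt φ (φ₁ y) y
  hasDerivAt_φ₁ : ∀ y ∈ S, HasDerivAt φ₁ (ψ y) y
  hasDerivAt_ψ : ∀ y ∈ S, HasDerivAt ψ (ψ₁ y) y
  hasDerivAt_ψ₁ : ∀ y ∈ S, HasDerivAt ψ₁ (ψ₂ y) y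
  ψ_pos : ∀ y ∈ S, 0 < ψ y
  ψ₁_nonpos : ∀ y ∈ S, ψ₁ y ≤ 0
  two_mul_sq_le : ∀ y ∈ S, 2 * ψ₁ y ^ 2 ≤ ψ y * ψ₂ y
  tangent_le : ∀ y ∈ S, ∀ z ∈ S, ∀ g k : ℝ,
    ψ y * g ^ 2 + ψ₁ y * (z - y) * g ^ 2 + 2 * ψ y * g * (k - g) ≤ ψ z * k ^ 2
  φ_tangent_le : ∀ y ∈ S, ∀ z ∈ S, φ y - φ z ≤ φ₁ y * (y - z)

/-- A nondecreasing `C¹` function on `[α, β]`, with derivative `g` vanishing at the endpoints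
and values in `[A, B]`. -/
structure NeumannMonotone (α β A B : ℝ) (v g : ℝ → ℝ) : Prop where
  continuousOn : ContinuousOn v (Icc α β)
  continuousOn_deriv : ContinuousOn g (Icc α β)
  hasDerivAt : ∀ x ∈ Ioo α β, HasDerivAt v (g x) x
  deriv_left : g α = 0
  deriv_right : g β = 0
  deriv_nonneg : ∀ x ∈ Icc α β, 0 ≤ g x
  mem_Icc : ∀ x ∈ Icc α β, v x ∈ Icc A B

/-- The resolvent equation `u - ε L u = v`, written for the flux `p g`, where `g = u'`. -/
def IsResolvent (α β ε : ℝ) (p w v u g : ℝ → ℝ) : Prop :=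
  ∀ x ∈ Ioo α β, HasDerivAt (fun x => p x * g x) (w x * ((u x - v x) / ε)) x

variable {α β A B ρ ε : ℝ} {σ b a p w φ φ₁ ψ ψ₁ ψ₂ v gv u g : ℝ → ℝ}

namespace DiffusionCoeffs

lemma continuous_p (h : DiffusionCoeffs ρ σ b a p w) : Continuous p :=
  continuous_iff_continuousAt.2 fun x => (h.hasDerivAt_p x).continuousAt

lemma w_pos (h : DiffusionCoeffs ρ σ b a p w) (x : ℝ) : 0 < w x := by
  rw [h.w_eq]; exact div_pos (h.p_pos x) (pow_pos (h.σ_pos x) 2)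

lemma continuous_w (h : DiffusionCoeffs ρ σ b a p w) : Continuous w := by
  rw [funext h.w_eq]
  exact h.continuous_p.div (h.σ_smooth.continuous.pow 2) fun x => (pow_pos (h.σ_pos x) 2).ne'

end DiffusionCoeffs

namespace EntropyFunction

variable {S : Set ℝ}

lemma continuousOn_φ (h : EntropyFunction S φ φ₁ ψ ψ₁ ψ₂) : ContinuousOn φ S :=
  fun y hy => (h.hasDerivAt_φ y hy).continuousAt.continuousWithinAt

lemma continuousOn_φ₁ (h : EntropyFunction S φ φ₁ ψ ψ₁ ψ₂) : ContinuousOn φ₁ S :=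
  fun y hy => (h.hasDerivAt_φ₁ y hy).continuousAt.continuousWithinAt

lemma continuousOn_ψ (h : EntropyFunction S φ φ₁ ψ ψ₁ ψ₂) : ContinuousOn ψ S :=
  fun y hy => (h.hasDerivAt_ψ y hy).continuousAt.continuousWithinAt

lemma continuousOn_ψ₁ (h : EntropyFunction S φ φ₁ ψ ψ₁ ψ₂) : ContinuousOn ψ₁ S :=
  fun y hy => (h.hasDerivAt_ψ₁ y hy).continuousAt.continuousWithinAt

end EntropyFunction

/-- The pointwise derivative computation behind the decay of the weighted energy. -/
lemma hasDerivAt_energyFlux {σ₁ b₁ a₁ a₂ q h h₁ : ℝ → ℝ} {x : ℝ}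
    (hσ : HasDerivAt σ (σ₁ x) x) (hb : HasDerivAt b (b₁ x) x) (ha : HasDerivAt a (a₁ x) x)
    (ha₁ : HasDerivAt a₁ (a₂ x) x) (hp : HasDerivAt p (p x * (b x / σ x ^ 2)) x)
    (hu : HasDerivAt u (q x / p x) x) (hq : HasDerivAt q (p x / σ x ^ 2 * h x) x)
    (hh : HasDerivAt h (h₁ x) x)
    (hψ : HasDerivAt ψ (ψ₁ (u x)) (u x)) (hψ₁ : HasDerivAt ψ₁ (ψ₂ (u x)) (u x))
    (hσ0 : 0 < σ x) (ha0 : 0 < a x) (hp0 : 0 < p x) :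
    HasDerivAt (fun x => ψ₁ (u x) * q x ^ 3 * σ x ^ 2 / p x ^ 2 + 2 * ψ (u x) * q x * h x
        - 2 * ψ (u x) * q x ^ 2 * (b x - σ x ^ 2 * a₁ x / a x) / p x)
      (p x * (ψ₁ (u x) * h x * (q x / p x) ^ 2 + 2 * ψ (u x) * (q x / p x) * h₁ x)
        + p x * (ψ₂ (u x) * (σ x * (q x / p x) ^ 2) ^ 2
          + 4 * ψ₁ (u x) * (σ x * (q x / p x) ^ 2)
            * ((h x - b x * (q x / p x)) / σ x + σ x * a₁ x * (q x / p x) / a x)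
          + 2 * ψ (u x)
            * ((h x - b x * (q x / p x)) / σ x + σ x * a₁ x * (q x / p x) / a x) ^ 2)
        + 2 * p x * σ x * (σ₁ x - σ x * a₁ x / a x) * ψ₁ (u x) * (q x / p x) ^ 3
        + 2 * p x * ψ (u x) * (q x / p x) ^ 2
          * ((σ x ^ 2 * a₂ x + (2 * σ x * σ₁ x + b x - 2 * σ x ^ 2 * a₁ x / a x) * a₁ x) / a x
            - b₁ x)) x := by
  have hψu : HasDerivAt (fun x => ψ (u x)) (ψ₁ (u x) * (q x / p x)) x := hψ.comp x hu
  have hψ₁u : HasDerivAt (fun x => ψ₁ (u x)) (ψ₂ (u x) * (q x / p x)) x := hψ₁.comp x hu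
  have key := ((((hψ₁u.fun_mul (hq.fun_pow 3)).fun_mul (hσ.fun_pow 2)).fun_div (hp.fun_pow 2)
    (pow_pos hp0 2).ne').fun_add (((hψu.const_mul 2).fun_mul hq).fun_mul hh)).fun_sub
    ((((hψu.const_mul 2).fun_mul (hq.fun_pow 2)).fun_mul
      (hb.fun_sub (((hσ.fun_pow 2).fun_mul ha₁).fun_div ha ha0.ne'))).fun_div hp hp0.ne')
  refine key.congr_deriv ?_
  field_simp
  ring

/-- One implicit Euler step contracts the energy `∫ p ψ(v) v'²` by the factor `1 + 2ρε`. -/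
lemma energy_resolvent_le (hαβ : α < β) (hε : 0 < ε) (hc : DiffusionCoeffs ρ σ b a p w)
    (he : EntropyFunction (Icc A B) φ φ₁ ψ ψ₁ ψ₂) (hv : NeumannMonotone α β A B v gv)
    (hu : NeumannMonotone α β A B u g) (hr : IsResolvent α β ε p w v u g) :
    (1 + 2 * ρ * ε) * ∫ x in α..β, p x * ψ (u x) * g x ^ 2
      ≤ ∫ x in α..β, p x * ψ (v x) * gv x ^ 2 := by
  have hcu : ContinuousOn (fun x => p x * ψ (u x) * g x ^ 2) (Icc α β) :=
    (hc.continuous_p.continuousOn.mul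
      (he.continuousOn_ψ.comp hu.continuousOn hu.mem_Icc)).mul (hu.continuousOn_deriv.pow 2)
  have hcv : ContinuousOn (fun x => p x * ψ (v x) * gv x ^ 2) (Icc α β) :=
    (hc.continuous_p.continuousOn.mul
      (he.continuousOn_ψ.comp hv.continuousOn hv.mem_Icc)).mul (hv.continuousOn_deriv.pow 2)
  have h2 := hc.a_smooth.differentiable (by simp)
  have ha' : ContDiff ℝ (⊤ : ℕ∞) (deriv a) := by
    simpa using (contDiff_infty_iff_deriv.1 hc.a_smooth).2
  set q : ℝ → ℝ := fun x => p x * g x with hq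
  set h : ℝ → ℝ := fun x => (u x - v x) / ε with hh
  have hqp : ∀ x, q x / p x = g x := fun x => by
    simp only [hq]; rw [mul_div_cancel_left₀ _ (hc.p_pos x).ne']
  set T : ℝ → ℝ := fun x => ψ₁ (u x) * q x ^ 3 * σ x ^ 2 / p x ^ 2 + 2 * ψ (u x) * q x * h x
        - 2 * ψ (u x) * q x ^ 2 * (b x - σ x ^ 2 * deriv a x / a x) / p x with hT
  have hqc : ContinuousOn q (Icc α β) := hc.continuous_p.continuousOn.mul hu.continuousOn_deriv
  have hhc : ContinuousOn h (Icc α β) := (hu.continuousOn.sub hv.continuousOn).div_const ε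
  have hψc : ContinuousOn (fun x => ψ (u x)) (Icc α β) :=
    he.continuousOn_ψ.comp hu.continuousOn hu.mem_Icc
  have hψ₁c : ContinuousOn (fun x => ψ₁ (u x)) (Icc α β) :=
    he.continuousOn_ψ₁.comp hu.continuousOn hu.mem_Icc
  have hTc : ContinuousOn T (Icc α β) := by
    have hσc := hc.σ_smooth.continuous.continuousOn (s := Icc α β)
    refine ContinuousOn.sub (ContinuousOn.add ?_ ?_) ?_
    · exact ((hψ₁c.mul (hqc.pow 3)).mul (hσc.pow 2)).div
        (hc.continuous_p.continuousOn.pow 2) fun x _ => (pow_pos (hc.p_pos x) 2).ne'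
    · exact ((continuousOn_const.mul hψc).mul hqc).mul hhc
    · exact (((continuousOn_const.mul hψc).mul (hqc.pow 2)).mul
        (hc.b_smooth.continuous.continuousOn.sub (((hσc.pow 2).mul ha'.continuous.continuousOn).div
          hc.a_smooth.continuous.continuousOn fun x _ => (hc.a_pos x).ne'))).div
        hc.continuous_p.continuousOn fun x _ => (hc.p_pos x).ne'
  have key := intervalIntegral.sub_le_integral_of_hasDeriv_right_of_le hαβ.le
    (g := fun x => -ε * T x) (continuousOn_const.mul hTc)
    (φ := fun x => p x * ψ (v x) * gv x ^ 2 - (1 + 2 * ρ * ε) * (p x * ψ (u x) * g x ^ 2))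
    (g' := fun x => -ε * deriv T x)
    (fun x hx => ?_) ((hcv.sub (continuousOn_const.mul hcu)).integrableOn_Icc) (fun x hx => ?_)
  · rw [intervalIntegral.integral_sub (hcv.intervalIntegrable_of_Icc hαβ.le)
      ((hcu.intervalIntegrable_of_Icc hαβ.le).const_mul _),
      intervalIntegral.integral_const_mul] at key
    simp only [hT, hq, hu.deriv_left, hu.deriv_right] at key
    norm_num at key
    linarith
  all_goals
    have hx' := Ioo_subset_Icc_self hx
    have hd := hasDerivAt_energyFlux (q := q) (h := h) (h₁ := fun x => (g x - gv x) / ε)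
      (hc.σ_smooth.differentiable (by simp) x).hasDerivAt
      (hc.b_smooth.differentiable (by simp) x).hasDerivAt
      (hc.a_smooth.differentiable (by simp) x).hasDerivAt
      (ha'.differentiable (by simp) x).hasDerivAt
      (hc.hasDerivAt_p x) (by rw [hqp]; exact hu.hasDerivAt x hx)
      (by simpa only [hc.w_eq] using hr x hx)
      (((hu.hasDerivAt x hx).sub (hv.hasDerivAt x hx)).div_const ε)
      (he.hasDerivAt_ψ _ (hu.mem_Icc x hx')) (he.hasDerivAt_ψ₁ _ (hu.mem_Icc x hx'))
      (hc.σ_pos x) (hc.a_pos x) (hc.p_pos x)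
  · exact (hd.differentiableAt.hasDerivAt.const_mul (-ε)).hasDerivWithinAt
  · have hdd := hd.deriv
    change deriv T x = _ at hdd
    simp only [hdd, hqp]
    have hp := hc.p_pos x
    have hσ := hc.σ_pos x
    have ha := hc.a_pos x
    have hψ := he.ψ_pos _ (hu.mem_Icc x hx')
    have hψ₁ := he.ψ₁_nonpos _ (hu.mem_Icc x hx')
    have hψ₂ := he.two_mul_sq_le _ (hu.mem_Icc x hx')
    have ht := he.tangent_le _ (hu.mem_Icc x hx') _ (hv.mem_Icc x hx') (g x) (gv x)
    have hg := hu.deriv_nonneg x hx'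
    have hV := hc.le_potV x
    simp only [potV, Lop, driftA] at hV
    set X := (h x - b x * g x) / σ x + σ x * deriv a x * g x / a x
    set Y := σ x * g x ^ 2
    set V := (σ x ^ 2 * deriv (deriv a) x +
      (2 * σ x * deriv σ x + b x - 2 * σ x ^ 2 * deriv a x / a x) * deriv a x) / a x - deriv b x
    have hquad : 0 ≤ ψ₂ (u x) * Y ^ 2 + 4 * ψ₁ (u x) * Y * X + 2 * ψ (u x) * X ^ 2 := by
      have : 0 ≤ ψ (u x) * (ψ₂ (u x) * Y ^ 2 + 4 * ψ₁ (u x) * Y * X + 2 * ψ (u x) * X ^ 2) := by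
        nlinarith [sq_nonneg (ψ₁ (u x) * Y + ψ (u x) * X), mul_nonneg (sub_nonneg.2 hψ₂)
          (sq_nonneg Y)]
      exact nonneg_of_mul_nonneg_right this hψ
    have hmon : 0 ≤ 2 * p x * σ x * (deriv σ x - σ x * deriv a x / a x) * ψ₁ (u x) * g x ^ 3 := by
      have h1 := hc.deriv_div_le x
      rw [deriv_fun_div (hc.σ_smooth.differentiable (by simp) x) (h2 x) ha.ne'] at h1
      have h3 : deriv σ x - σ x * deriv a x / a x ≤ 0 := by
        have : deriv σ x - σ x * deriv a x / a x
          = (deriv σ x * a x - σ x * deriv a x) / a x ^ 2 * a x := by field_simp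
        rw [this]; exact mul_nonpos_of_nonpos_of_nonneg h1 ha.le
      have h4 := mul_nonneg_of_nonpos_of_nonpos h3 hψ₁
      have h5 : 0 ≤ 2 * p x * σ x * g x ^ 3 := by positivity
      nlinarith [mul_nonneg h5 h4]
    have hpot : 2 * p x * ψ (u x) * g x ^ 2 * ρ ≤ 2 * p x * ψ (u x) * g x ^ 2 * V :=
      mul_le_mul_of_nonneg_left hV (by positivity)
    have ht' := mul_le_mul_of_nonneg_left ht hp.le
    have e1 : v x - u x = -ε * h x := by simp only [hh]; field_simp; ring
    have e2 : gv x - g x = -ε * ((g x - gv x) / ε) := by field_simp; ring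
    rw [e1] at ht'
    rw [e2] at ht'
    set h₁ := (g x - gv x) / ε
    have hsum := mul_nonneg hε.le (add_nonneg (add_nonneg (mul_nonneg hp.le hquad) hmon)
      (sub_nonneg.2 hpot))
    linarith

lemma resolvent_integral_eq (hαβ : α < β) (hε : 0 < ε) (hc : DiffusionCoeffs ρ σ b a p w)
    (hv : NeumannMonotone α β A B v gv) (hu : NeumannMonotone α β A B u g)
    (hr : IsResolvent α β ε p w v u g) :
    ∫ x in α..β, w x * u x = ∫ x in α..β, w x * v x := by
  have hwu : ContinuousOn (fun x => w x * u x) (Icc α β) :=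
    hc.continuous_w.continuousOn.mul hu.continuousOn
  have hwv : ContinuousOn (fun x => w x * v x) (Icc α β) :=
    hc.continuous_w.continuousOn.mul hv.continuousOn
  have key := intervalIntegral.integral_eq_sub_of_hasDerivAt_of_le hαβ.le
    (f := fun x => ε * (p x * g x)) (f' := fun x => w x * u x - w x * v x)
    (continuousOn_const.mul (hc.continuous_p.continuousOn.mul hu.continuousOn_deriv))
    (fun x hx => ((hr x hx).const_mul ε).congr_deriv (by field_simp))
    ((hwu.sub hwv).intervalIntegrable_of_Icc hαβ.le)
  rw [intervalIntegral.integral_sub (hwu.intervalIntegrable_of_Icc hαβ.le)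
    (hwv.intervalIntegrable_of_Icc hαβ.le)] at key
  simp only [hu.deriv_left, hu.deriv_right] at key
  linarith

/-- Entropy dissipation along one implicit Euler step. -/
lemma integral_phi_sub_le (hαβ : α < β) (hε : 0 < ε) (hc : DiffusionCoeffs ρ σ b a p w)
    (he : EntropyFunction (Icc A B) φ φ₁ ψ ψ₁ ψ₂) (hv : NeumannMonotone α β A B v gv)
    (hu : NeumannMonotone α β A B u g) (hr : IsResolvent α β ε p w v u g) {η : ℝ}
    (hη : ∀ x ∈ Icc α β, ψ (v x) ≤ (1 + η) * ψ (u x)) :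
    (∫ x in α..β, w x * φ (v x)) - ∫ x in α..β, w x * φ (u x)
      ≤ ε / 2 * ((∫ x in α..β, p x * ψ (v x) * gv x ^ 2)
        + (1 + η) * ∫ x in α..β, p x * ψ (u x) * g x ^ 2) := by
  have hcu : ContinuousOn (fun x => p x * ψ (u x) * g x ^ 2) (Icc α β) :=
    (hc.continuous_p.continuousOn.mul
      (he.continuousOn_ψ.comp hu.continuousOn hu.mem_Icc)).mul (hu.continuousOn_deriv.pow 2)
  have hcv : ContinuousOn (fun x => p x * ψ (v x) * gv x ^ 2) (Icc α β) :=
    (hc.continuous_p.continuousOn.mul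
      (he.continuousOn_ψ.comp hv.continuousOn hv.mem_Icc)).mul (hv.continuousOn_deriv.pow 2)
  have hwu : ContinuousOn (fun x => w x * φ (u x)) (Icc α β) :=
    hc.continuous_w.continuousOn.mul (he.continuousOn_φ.comp hu.continuousOn hu.mem_Icc)
  have hwv : ContinuousOn (fun x => w x * φ (v x)) (Icc α β) :=
    hc.continuous_w.continuousOn.mul (he.continuousOn_φ.comp hv.continuousOn hv.mem_Icc)
  have icu := hcu.intervalIntegrable_of_Icc (μ := volume) hαβ.le
  have icv := hcv.intervalIntegrable_of_Icc (μ := volume) hαβ.le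
  have iwu := hwu.intervalIntegrable_of_Icc (μ := volume) hαβ.le
  have iwv := hwv.intervalIntegrable_of_Icc (μ := volume) hαβ.le
  have key := intervalIntegral.sub_le_integral_of_hasDeriv_right_of_le hαβ.le
    (g := fun x => ε * (φ₁ (v x) * (p x * g x)))
    (continuousOn_const.mul ((he.continuousOn_φ₁.comp hv.continuousOn hv.mem_Icc).mul
      (hc.continuous_p.continuousOn.mul hu.continuousOn_deriv)))
    (φ := fun x => ε / 2 * (p x * ψ (v x) * gv x ^ 2 + (1 + η) * (p x * ψ (u x) * g x ^ 2))
      - (w x * φ (v x) - w x * φ (u x)))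
    (g' := fun x => ε * (ψ (v x) * gv x * (p x * g x)
      + φ₁ (v x) * (w x * ((u x - v x) / ε))))
    (fun x hx => ((((he.hasDerivAt_φ₁ _ (hv.mem_Icc x (Ioo_subset_Icc_self hx))).comp x
      (hv.hasDerivAt x hx)).mul (hr x hx)).const_mul ε).hasDerivWithinAt)
    (((continuousOn_const.mul (hcv.add (continuousOn_const.mul hcu))).sub
      (hwv.sub hwu)).integrableOn_Icc) (fun x hx => ?_)
  · rw [intervalIntegral.integral_sub ((icv.add (icu.const_mul _)).const_mul _) (iwv.sub iwu),
      intervalIntegral.integral_const_mul, intervalIntegral.integral_add icv (icu.const_mul _),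
      intervalIntegral.integral_const_mul, intervalIntegral.integral_sub iwv iwu] at key
    simp only [hu.deriv_left, hu.deriv_right] at key
    linarith
  · have hx' := Ioo_subset_Icc_self hx
    have h1 := mul_le_mul_of_nonneg_left
      (he.φ_tangent_le _ (hv.mem_Icc x hx') _ (hu.mem_Icc x hx')) (hc.w_pos x).le
    have h2 := mul_le_mul_of_nonneg_right (mul_le_mul_of_nonneg_left (hη x hx') (hc.p_pos x).le)
      (sq_nonneg (g x))
    have h3 : 0 ≤ p x * ψ (v x) * (gv x - g x) ^ 2 :=
      mul_nonneg (mul_nonneg (hc.p_pos x).le (he.ψ_pos _ (hv.mem_Icc x hx')).le) (sq_nonneg _)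
    have e : ε * (φ₁ (v x) * (w x * ((u x - v x) / ε))) = - (w x * (φ₁ (v x) * (v x - u x))) := by
      field_simp; ring
    have h4 := mul_nonneg hε.le (add_nonneg h3 (sub_nonneg.2 h2))
    linarith

/-- The unnormalised `φ`-entropy on `[α, β]`. -/
noncomputable def intervalEntropy (α β : ℝ) (w φ v : ℝ → ℝ) : ℝ :=
  (∫ x in α..β, w x * φ (v x))
    - (∫ x in α..β, w x) * φ ((∫ x in α..β, w x * v x) / ∫ x in α..β, w x)

/-- A crude bound of the entropy by the energy, with an arbitrarily small additive error. -/
lemma exists_intervalEntropy_le (hαβ : α < β) (hAB : A ≤ B) (hc : DiffusionCoeffs ρ σ b a p w)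
    (he : EntropyFunction (Icc A B) φ φ₁ ψ ψ₁ ψ₂) :
    ∃ C : ℝ, ∀ v gv : ℝ → ℝ, NeumannMonotone α β A B v gv → ∀ δ > 0,
      intervalEntropy α β w φ v ≤ C * (δ + (∫ x in α..β, p x * ψ (v x) * gv x ^ 2) / δ) := by
  obtain ⟨x₀, hx₀, hp₀⟩ := (isCompact_Icc (a := α) (b := β)).exists_isMinOn
    (nonempty_Icc.2 hαβ.le) hc.continuous_p.continuousOn
  obtain ⟨y₀, hy₀, hψ₀⟩ := (isCompact_Icc (a := A) (b := B)).exists_isMinOn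
    (nonempty_Icc.2 hAB) he.continuousOn_ψ
  obtain ⟨M, hM⟩ := (isCompact_Icc (a := A) (b := B)).exists_bound_of_continuousOn he.continuousOn_φ₁
  have hM0 : 0 ≤ M := (norm_nonneg _).trans (hM A ⟨le_rfl, hAB⟩)
  set c := p x₀ * ψ y₀
  have hcpos : 0 < c := mul_pos (hc.p_pos _) (he.ψ_pos _ hy₀)
  set W := ∫ x in α..β, w x with hW
  have iw : IntervalIntegrable w volume α β := hc.continuous_w.intervalIntegrable _ _
  have hWpos : 0 < W := intervalIntegral.intervalIntegral_pos_of_pos iw hc.w_pos hαβ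
  set K := max (β - α) (1 / (4 * c))
  have hK0 : 0 ≤ K := le_max_of_le_left (by linarith)
  refine ⟨W * M * K, fun v gv hv δ hδ => ?_⟩
  set J := ∫ x in α..β, p x * ψ (v x) * gv x ^ 2 with hJ
  have hαm : α ∈ Icc α β := ⟨le_rfl, hαβ.le⟩
  have hβm : β ∈ Icc α β := ⟨hαβ.le, le_rfl⟩
  have hcv : ContinuousOn (fun x => p x * ψ (v x) * gv x ^ 2) (Icc α β) :=
    (hc.continuous_p.continuousOn.mul
      (he.continuousOn_ψ.comp hv.continuousOn hv.mem_Icc)).mul (hv.continuousOn_deriv.pow 2)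
  have icv := hcv.intervalIntegrable_of_Icc (μ := volume) hαβ.le
  have hJ0 : 0 ≤ J := intervalIntegral.integral_nonneg hαβ.le fun x hx =>
    mul_nonneg (mul_nonneg (hc.p_pos x).le (he.ψ_pos _ (hv.mem_Icc x hx)).le) (sq_nonneg _)
  have hmono : MonotoneOn v (Icc α β) := by
    refine monotoneOn_of_deriv_nonneg (convex_Icc _ _) hv.continuousOn ?_ ?_ <;>
      rw [interior_Icc]
    · exact fun y hy => (hv.hasDerivAt y hy).differentiableAt.differentiableWithinAt
    · exact fun y hy => by
        rw [(hv.hasDerivAt y hy).deriv]; exact hv.deriv_nonneg y (Ioo_subset_Icc_self hy)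
  have hosc : v β - v α ≤ K * (δ + J / δ) := by
    have h1 : v β - v α ≤ ∫ x in α..β, (δ + 1 / (4 * c * δ) * (p x * ψ (v x) * gv x ^ 2)) := by
      refine intervalIntegral.sub_le_integral_of_hasDeriv_right_of_le hαβ.le hv.continuousOn
        (fun x hx => (hv.hasDerivAt x hx).hasDerivWithinAt)
        ((continuousOn_const.add (continuousOn_const.mul hcv)).integrableOn_Icc) fun x hx => ?_
      have hx' := Ioo_subset_Icc_self hx
      have h2 : c ≤ p x * ψ (v x) := mul_le_mul (hp₀ hx') (hψ₀ (hv.mem_Icc x hx'))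
        (he.ψ_pos _ hy₀).le (hc.p_pos x).le
      have h3 := mul_le_mul_of_nonneg_right h2 (sq_nonneg (gv x))
      have h4 : gv x = δ + 1 / (4 * c * δ) * (c * gv x ^ 2) - (gv x - 2 * δ) ^ 2 / (4 * δ) := by
        field_simp; ring
      have h5 : 0 ≤ (gv x - 2 * δ) ^ 2 / (4 * δ) := by positivity
      have h6 := mul_le_mul_of_nonneg_left h3 (by positivity : 0 ≤ 1 / (4 * c * δ))
      linarith
    rw [intervalIntegral.integral_add intervalIntegrable_const (icv.const_mul _),
      intervalIntegral.integral_const_mul, intervalIntegral.integral_const, smul_eq_mul] at h1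
    have h2 : (β - α) * δ ≤ K * δ := mul_le_mul_of_nonneg_right (le_max_left _ _) hδ.le
    have h3 : 1 / (4 * c) * (J / δ) ≤ K * (J / δ) :=
      mul_le_mul_of_nonneg_right (le_max_right _ _) (by positivity)
    have h4 : 1 / (4 * c * δ) * J = 1 / (4 * c) * (J / δ) := by field_simp
    linarith
  set m := (∫ x in α..β, w x * v x) / W with hm
  have iwv : IntervalIntegrable (fun x => w x * v x) volume α β :=
    (hc.continuous_w.continuousOn.mul hv.continuousOn).intervalIntegrable_of_Icc hαβ.le
  have hmem : m ∈ Icc (v α) (v β) := by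
    rw [hm, mem_Icc, le_div_iff₀ hWpos, div_le_iff₀ hWpos, hW,
      ← intervalIntegral.integral_const_mul, ← intervalIntegral.integral_const_mul]
    refine ⟨intervalIntegral.integral_mono_on hαβ.le (iw.const_mul _) iwv fun x hx => ?_,
      intervalIntegral.integral_mono_on hαβ.le iwv (iw.const_mul _) fun x hx => ?_⟩
    · rw [mul_comm]
      exact mul_le_mul_of_nonneg_left (hmono hαm hx hx.1) (hc.w_pos x).le
    · rw [mul_comm (v β)]
      exact mul_le_mul_of_nonneg_left (hmono hx hβm hx.2) (hc.w_pos x).le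
  have hmAB : m ∈ Icc A B := ⟨(hv.mem_Icc α hαm).1.trans hmem.1, hmem.2.trans (hv.mem_Icc β hβm).2⟩
  have hle : ∀ x ∈ Icc α β, w x * φ (v x) ≤ (φ m + M * (v β - v α)) * w x := by
    intro x hx
    have h1 := he.φ_tangent_le _ (hv.mem_Icc x hx) _ hmAB
    have h2 : φ₁ (v x) * (v x - m) ≤ M * (v β - v α) := by
      refine (le_abs_self _).trans ?_
      rw [abs_mul]
      refine mul_le_mul (hM _ (hv.mem_Icc x hx)) ?_ (abs_nonneg _) hM0
      have h3 := hmono hαm hx hx.1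
      have h4 := hmono hx hβm hx.2
      rw [abs_le]; constructor <;> linarith [hmem.1, hmem.2]
    rw [mul_comm]
    exact mul_le_mul_of_nonneg_right (by linarith) (hc.w_pos x).le
  have hint := intervalIntegral.integral_mono_on hαβ.le
    ((hc.continuous_w.continuousOn.mul
      (he.continuousOn_φ.comp hv.continuousOn hv.mem_Icc)).intervalIntegrable_of_Icc hαβ.le)
    (iw.const_mul _) hle
  rw [intervalIntegral.integral_const_mul] at hint
  have hfin := mul_le_mul_of_nonneg_left hosc (mul_nonneg hWpos.le hM0)
  simp only [intervalEntropy, ← hW, ← hm]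
  simp only [Pi.mul_apply, Function.comp_def, ← hW] at hint
  linarith

/-- Existence of the resolvent in the class of nondecreasing Neumann functions. -/
lemma exists_resolvent (hαβ : α < β) (hε : 0 < ε) (hc : DiffusionCoeffs ρ σ b a p w)
    (hv : NeumannMonotone α β A B v gv) :
    ∃ u g, NeumannMonotone α β A B u g ∧ IsResolvent α β ε p w v u g := by
  have hP : ∀ x ∈ Icc α β, 0 < 1 / p x := fun x _ => one_div_pos.2 (hc.p_pos x)
  have hQ : ∀ x ∈ Icc α β, 0 < w x / ε := fun x _ => div_pos (hc.w_pos x) hε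
  have hPc : ContinuousOn (fun x => 1 / p x) (Icc α β) :=
    continuousOn_const.div hc.continuous_p.continuousOn fun x _ => (hc.p_pos x).ne'
  obtain ⟨u, q, hqα, hqβ, huc, hqc, hud, hqd⟩ := exists_neumann hαβ hPc
    (hc.continuous_w.continuousOn.div_const ε) hv.continuousOn hP hQ
  have hq0 := neumann_flux_nonneg hαβ hP hQ huc hqc hv.continuousOn hud hqd hv.hasDerivAt hqα hqβ
    hv.deriv_nonneg
  have hB := neumann_le hαβ hP hQ huc hqc hud hqd hqα hqβ fun x hx => (hv.mem_Icc x hx).2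
  have hA := neumann_le hαβ hP hQ (u := fun x => -u x) (q := fun x => -q x) (v := fun x => -v x)
    (C := -A) huc.neg hqc.neg (fun y hy => (hud y hy).fun_neg.congr_deriv (by ring))
    (fun y hy => (hqd y hy).fun_neg.congr_deriv (by ring)) (by simp [hqα]) (by simp [hqβ])
    fun x hx => neg_le_neg (hv.mem_Icc x hx).1
  refine ⟨u, fun x => 1 / p x * q x, ⟨huc, hPc.mul hqc, hud, by simp [hqα], by simp [hqβ],
    fun x hx => mul_nonneg (hP x hx).le (hq0 x hx),
    fun x hx => ⟨by linarith [hA x hx], hB x hx⟩⟩, fun x hx => ?_⟩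
  have e : (fun x => p x * (1 / p x * q x)) = q := by
    funext y
    have := (hc.p_pos y).ne'
    field_simp
  rw [e]
  exact (hqd x hx).congr_deriv (by ring)

lemma resolvent_sub_abs_le (hαβ : α < β) (hε : 0 < ε) (hc : DiffusionCoeffs ρ σ b a p w)
    (hv : NeumannMonotone α β A B v gv) (hu : NeumannMonotone α β A B u g)
    (hr : IsResolvent α β ε p w v u g) {l : ℝ → ℝ} {K : ℝ}
    (hl : ∀ x ∈ Ioo α β, HasDerivAt (fun x => p x * gv x) (w x * l x) x)
    (hK : ∀ x ∈ Icc α β, |l x| ≤ K) : ∀ x ∈ Icc α β, |u x - v x| ≤ ε * K := by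
  refine neumann_abs_le hαβ (P := fun x => 1 / p x) (Q := fun x => w x / ε)
    (u := fun x => u x - v x) (q := fun x => p x * g x - p x * gv x) (v := fun x => ε * l x)
    (fun x _ => one_div_pos.2 (hc.p_pos x)) (fun x _ => div_pos (hc.w_pos x) hε)
    (hu.continuousOn.sub hv.continuousOn)
    ((hc.continuous_p.continuousOn.mul hu.continuousOn_deriv).sub
      (hc.continuous_p.continuousOn.mul hv.continuousOn_deriv))
    (fun x hx => ((hu.hasDerivAt x hx).sub (hv.hasDerivAt x hx)).congr_deriv ?_)
    (fun x hx => ((hr x hx).sub (hl x hx)).congr_deriv ?_)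
    (by simp [hu.deriv_left, hv.deriv_left]) (by simp [hu.deriv_right, hv.deriv_right])
    fun x hx => ?_
  · have := (hc.p_pos x).ne'
    field_simp
  · field_simp
  · rw [abs_mul, abs_of_pos hε]
    exact mul_le_mul_of_nonneg_left (hK x hx) hε.le

/-- One implicit Euler step: the energy contracts and `entropy - c * energy` increases. -/
lemma exists_euler_step (hαβ : α < β) (hε : 0 < ε) (hc : DiffusionCoeffs ρ σ b a p w)
    (he : EntropyFunction (Icc A B) φ φ₁ ψ ψ₁ ψ₂) {K κ : ℝ} (hκ : 0 ≤ κ)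
    (hψ : ∀ y ∈ Icc A B, ∀ z ∈ Icc A B, |z - y| ≤ ε * K → ψ y ≤ (1 + κ * ε) * ψ z)
    (hv : NeumannMonotone α β A B v gv) {l : ℝ → ℝ}
    (hl : ∀ x ∈ Ioo α β, HasDerivAt (fun x => p x * gv x) (w x * l x) x)
    (hK : ∀ x ∈ Icc α β, |l x| ≤ K) :
    ∃ u g l' : ℝ → ℝ, NeumannMonotone α β A B u g
      ∧ (∀ x ∈ Ioo α β, HasDerivAt (fun x => p x * g x) (w x * l' x) x)
      ∧ (∀ x ∈ Icc α β, |l' x| ≤ K)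
      ∧ (1 + 2 * ρ * ε) * (∫ x in α..β, p x * ψ (u x) * g x ^ 2)
        ≤ ∫ x in α..β, p x * ψ (v x) * gv x ^ 2
      ∧ intervalEntropy α β w φ v - (1 + κ * ε) * (1 + 2 * ρ * ε) / (2 * ρ)
          * (∫ x in α..β, p x * ψ (v x) * gv x ^ 2)
        ≤ intervalEntropy α β w φ u - (1 + κ * ε) * (1 + 2 * ρ * ε) / (2 * ρ)
          * ∫ x in α..β, p x * ψ (u x) * g x ^ 2 := by
  obtain ⟨u, g, hu, hr⟩ := exists_resolvent hαβ hε hc hv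
  have hsub := resolvent_sub_abs_le hαβ hε hc hv hu hr hl hK
  have hA := energy_resolvent_le hαβ hε hc he hv hu hr
  have hB := integral_phi_sub_le hαβ hε hc he hv hu hr (η := κ * ε) fun x hx =>
    hψ _ (hv.mem_Icc x hx) _ (hu.mem_Icc x hx) (hsub x hx)
  refine ⟨u, g, fun x => (u x - v x) / ε, hu, hr, fun x hx => ?_, hA, ?_⟩
  · rw [abs_div, abs_of_pos hε, div_le_iff₀ hε, mul_comm]
    exact hsub x hx
  · have hJ0 : 0 ≤ ∫ x in α..β, p x * ψ (u x) * g x ^ 2 :=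
      intervalIntegral.integral_nonneg hαβ.le fun x hx =>
        mul_nonneg (mul_nonneg (hc.p_pos x).le (he.ψ_pos _ (hu.mem_Icc x hx)).le) (sq_nonneg _)
    have hρ := hc.ρ_pos
    simp only [intervalEntropy, resolvent_integral_eq hαβ hε hc hv hu hr]
    generalize (∫ x in α..β, p x * ψ (u x) * g x ^ 2) = Ju at *
    generalize (∫ x in α..β, p x * ψ (v x) * gv x ^ 2) = Jv at *
    have hρε : 0 < ρ * ε := mul_pos hρ hε
    have hκε : 0 ≤ κ * ε := mul_nonneg hκ hε.le
    suffices h : ε / 2 * (Jv + (1 + κ * ε) * Ju)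
        ≤ (1 + κ * ε) * (1 + 2 * ρ * ε) / (2 * ρ) * (Jv - Ju) by linarith
    have hD := sub_nonneg.2 hA
    have e : (1 + κ * ε) * (1 + 2 * ρ * ε) / (2 * ρ) * (Jv - Ju)
        - ε / 2 * (Jv + (1 + κ * ε) * Ju)
        = ((Jv - (1 + 2 * ρ * ε) * Ju) * (1 + κ * ε + ρ * ε + κ * ε * (2 * (ρ * ε)))
          + 2 * (ρ * ε) * Ju * (κ * ε / 2 + ρ * ε + κ * ε * (2 * (ρ * ε)))) / (2 * ρ) := by
      field_simp
      ring
    rw [← sub_nonneg, e]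
    positivity

lemma exists_euler_iterate (hαβ : α < β) (hε : 0 < ε) (hc : DiffusionCoeffs ρ σ b a p w)
    (he : EntropyFunction (Icc A B) φ φ₁ ψ ψ₁ ψ₂) {K κ : ℝ} (hκ : 0 ≤ κ)
    (hψ : ∀ y ∈ Icc A B, ∀ z ∈ Icc A B, |z - y| ≤ ε * K → ψ y ≤ (1 + κ * ε) * ψ z)
    (hv : NeumannMonotone α β A B v gv) {l : ℝ → ℝ}
    (hl : ∀ x ∈ Ioo α β, HasDerivAt (fun x => p x * gv x) (w x * l x) x)
    (hK : ∀ x ∈ Icc α β, |l x| ≤ K) (n : ℕ) :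
    ∃ u g l' : ℝ → ℝ, NeumannMonotone α β A B u g
      ∧ (∀ x ∈ Ioo α β, HasDerivAt (fun x => p x * g x) (w x * l' x) x)
      ∧ (∀ x ∈ Icc α β, |l' x| ≤ K)
      ∧ (1 + 2 * ρ * ε) ^ n * (∫ x in α..β, p x * ψ (u x) * g x ^ 2)
        ≤ ∫ x in α..β, p x * ψ (v x) * gv x ^ 2
      ∧ intervalEntropy α β w φ v - (1 + κ * ε) * (1 + 2 * ρ * ε) / (2 * ρ)
          * (∫ x in α..β, p x * ψ (v x) * gv x ^ 2)
        ≤ intervalEntropy α β w φ u - (1 + κ * ε) * (1 + 2 * ρ * ε) / (2 * ρ)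
          * ∫ x in α..β, p x * ψ (u x) * g x ^ 2 := by
  induction n with
  | zero => exact ⟨v, gv, l, hv, hl, hK, by simp, le_rfl⟩
  | succ n ih =>
    obtain ⟨u, g, l', hu, hl', hK', hJ, hE⟩ := ih
    obtain ⟨u₂, g₂, l₂, hu₂, hl₂, hK₂, hJ₂, hE₂⟩ := exists_euler_step hαβ hε hc he hκ hψ hu hl' hK'
    refine ⟨u₂, g₂, l₂, hu₂, hl₂, hK₂, ?_, hE.trans hE₂⟩
    have hpos : 0 < 1 + 2 * ρ * ε := by have := mul_pos hc.ρ_pos hε; linarith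
    rw [pow_succ, mul_assoc]
    exact (mul_le_mul_of_nonneg_left hJ₂ (pow_pos hpos n).le).trans hJ

/-- On a compact interval, `ψ` varies slowly at scale `ε`, in the multiplicative sense. -/
lemma EntropyFunction.exists_psi_le (hAB : A ≤ B) (he : EntropyFunction (Icc A B) φ φ₁ ψ ψ₁ ψ₂)
    (hψ₁ : ContinuousOn ψ₁ (Icc A B)) {K : ℝ} (hK : 0 ≤ K) :
    ∃ κ : ℝ, 0 ≤ κ ∧ ∀ ε > 0, ∀ y ∈ Icc A B, ∀ z ∈ Icc A B, |z - y| ≤ ε * K →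
      ψ y ≤ (1 + κ * ε) * ψ z := by
  obtain ⟨y₀, hy₀, hmin⟩ := (isCompact_Icc (a := A) (b := B)).exists_isMinOn
    (nonempty_Icc.2 hAB) he.continuousOn_ψ
  obtain ⟨M, hM⟩ := (isCompact_Icc (a := A) (b := B)).exists_bound_of_continuousOn hψ₁
  have hM0 : 0 ≤ M := (norm_nonneg _).trans (hM A ⟨le_rfl, hAB⟩)
  have h0 := he.ψ_pos _ hy₀
  refine ⟨M * K / ψ y₀, by positivity, fun ε hε y hy z hz hzy => ?_⟩
  have h1 := (convex_Icc A B).norm_image_sub_le_of_norm_hasDerivWithin_le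
    (fun x hx => (he.hasDerivAt_ψ x hx).hasDerivWithinAt) hM hz hy
  rw [Real.norm_eq_abs, Real.norm_eq_abs, abs_sub_comm y z] at h1
  have h2 : M * |z - y| ≤ M * (ε * K) := mul_le_mul_of_nonneg_left hzy hM0
  have h3 : M * (ε * K) = M * K / ψ y₀ * ε * ψ y₀ := by field_simp
  have h4 : M * K / ψ y₀ * ε * ψ y₀ ≤ M * K / ψ y₀ * ε * ψ z :=
    mul_le_mul_of_nonneg_left (hmin hz) (by positivity)
  linarith [le_abs_self (ψ y - ψ z)]

/-- The entropy inequality on a compact interval with Neumann boundary conditions. -/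
theorem intervalEntropy_le (hαβ : α < β) (hAB : A ≤ B) (hc : DiffusionCoeffs ρ σ b a p w)
    (he : EntropyFunction (Icc A B) φ φ₁ ψ ψ₁ ψ₂) (hv : NeumannMonotone α β A B v gv) {l : ℝ → ℝ}
    (hl : ∀ x ∈ Ioo α β, HasDerivAt (fun x => p x * gv x) (w x * l x) x)
    (hlc : ContinuousOn l (Icc α β)) :
    2 * ρ * intervalEntropy α β w φ v ≤ ∫ x in α..β, p x * ψ (v x) * gv x ^ 2 := by
  have hρ := hc.ρ_pos
  obtain ⟨K, hK⟩ := (isCompact_Icc (a := α) (b := β)).exists_bound_of_continuousOn hlc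
  have hK0 : 0 ≤ K := (norm_nonneg _).trans (hK α ⟨le_rfl, hαβ.le⟩)
  obtain ⟨κ, hκ, hψ⟩ := he.exists_psi_le hAB he.continuousOn_ψ₁ hK0
  obtain ⟨C, hC⟩ := exists_intervalEntropy_le hαβ hAB hc he
  set J := ∫ x in α..β, p x * ψ (v x) * gv x ^ 2 with hJ
  have hstep : ∀ ε > 0, intervalEntropy α β w φ v
      ≤ (1 + κ * ε) * (1 + 2 * ρ * ε) / (2 * ρ) * J := by
    intro ε hε
    have hr : 1 < 1 + 2 * ρ * ε := by have := mul_pos hρ hε; linarith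
    have hδ : ∀ δ > 0, intervalEntropy α β w φ v
        ≤ (1 + κ * ε) * (1 + 2 * ρ * ε) / (2 * ρ) * J + |C| * δ := by
      intro δ hδ
      have ht : Tendsto (fun n : ℕ => (1 + κ * ε) * (1 + 2 * ρ * ε) / (2 * ρ) * J
          + |C| * (δ + J / δ * ((1 + 2 * ρ * ε)⁻¹) ^ n)) atTop
          (𝓝 ((1 + κ * ε) * (1 + 2 * ρ * ε) / (2 * ρ) * J + |C| * (δ + J / δ * 0))) :=
        ((((tendsto_pow_atTop_nhds_zero_of_lt_one (by positivity)
          (inv_lt_one_of_one_lt₀ hr)).const_mul _).const_add _).const_mul _).const_add _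
      rw [mul_zero, add_zero] at ht
      refine ge_of_tendsto' ht fun n => ?_
      obtain ⟨u, g, l', hu, -, -, hJu, hE⟩ :=
        exists_euler_iterate hαβ hε hc he hκ (hψ ε hε) hv hl hK n
      have h1 := hC u g hu δ hδ
      have hJ0 : 0 ≤ ∫ x in α..β, p x * ψ (u x) * g x ^ 2 :=
        intervalIntegral.integral_nonneg hαβ.le fun x hx =>
          mul_nonneg (mul_nonneg (hc.p_pos x).le (he.ψ_pos _ (hu.mem_Icc x hx)).le) (sq_nonneg _)
      generalize (∫ x in α..β, p x * ψ (u x) * g x ^ 2) = Ju at *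
      have h2 : Ju ≤ J * ((1 + 2 * ρ * ε)⁻¹) ^ n := by
        rw [inv_pow, ← div_eq_mul_inv, le_div_iff₀ (by positivity), mul_comm]
        exact hJu
      have h3 : C * (δ + Ju / δ) ≤ |C| * (δ + Ju / δ) :=
        mul_le_mul_of_nonneg_right (le_abs_self C) (by positivity)
      have h4 : |C| * (δ + Ju / δ) ≤ |C| * (δ + J / δ * ((1 + 2 * ρ * ε)⁻¹) ^ n) := by
        refine mul_le_mul_of_nonneg_left ?_ (abs_nonneg C)
        rw [div_mul_eq_mul_div]
        gcongr
      have h5 : 0 ≤ (1 + κ * ε) * (1 + 2 * ρ * ε) / (2 * ρ) * Ju := by positivity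
      linarith
    have ht : Tendsto (fun δ : ℝ => (1 + κ * ε) * (1 + 2 * ρ * ε) / (2 * ρ) * J + |C| * δ)
        (𝓝[>] 0) (𝓝 ((1 + κ * ε) * (1 + 2 * ρ * ε) / (2 * ρ) * J + |C| * 0)) :=
      ((Continuous.tendsto (by fun_prop) 0).mono_left nhdsWithin_le_nhds)
    rw [mul_zero, add_zero] at ht
    exact ge_of_tendsto ht (eventually_nhdsWithin_of_forall hδ)
  have ht : Tendsto (fun ε : ℝ => (1 + κ * ε) * (1 + 2 * ρ * ε) / (2 * ρ) * J)
      (𝓝[>] 0) (𝓝 ((1 + κ * 0) * (1 + 2 * ρ * 0) / (2 * ρ) * J)) :=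
    ((Continuous.tendsto (by fun_prop) 0).mono_left nhdsWithin_le_nhds)
  have hfin := ge_of_tendsto ht (eventually_nhdsWithin_of_forall hstep)
  rw [mul_zero, mul_zero, add_zero, one_mul, div_mul_eq_mul_div, le_div_iff₀ (by positivity)]
    at hfin
  linarith

end Interval

section Entropy

/-- The tangent line of a convex function lies below its graph. -/
lemma ConvexOn.add_mul_sub_le_of_hasDerivAt {S : Set ℝ} {F : ℝ → ℝ} {F' y z : ℝ}
    (hF : ConvexOn ℝ S F) (hy : y ∈ S) (hz : z ∈ S) (hd : HasDerivAt F F' y) :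
    F y + F' * (z - y) ≤ F z := by
  rcases lt_trichotomy y z with h | rfl | h
  · have := hF.le_slope_of_hasDerivAt hy hz h hd
    rw [slope_def_field, le_div_iff₀ (by linarith)] at this
    linarith
  · simp
  · have := hF.slope_le_of_hasDerivAt hz hy h hd
    rw [slope_def_field, div_le_iff₀ (by linarith)] at this
    linarith

lemma ConvexOn.nonneg_of_hasDerivAt_of_hasDerivAt {S : Set ℝ} {F F' : ℝ → ℝ} {F'' y : ℝ}
    (hF : ConvexOn ℝ S F) (hS : IsOpen S) (hy : y ∈ S) (hd : ∀ x ∈ S, HasDerivAt F (F' x) x)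
    (hd' : HasDerivAt F' F'' y) : 0 ≤ F'' := by
  have hmono : MonotoneOn F' S :=
    (hF.monotoneOn_deriv fun x hx => (hd x hx).differentiableAt).congr fun x hx => (hd x hx).deriv
  exact (hd'.hasDerivWithinAt (s := S)).nonneg_of_monotoneOn
    (uniqueDiffWithinAt_iff_accPt.1 (hS.uniqueDiffWithinAt (𝕜 := ℝ) hy)) hmono

lemma EntropyFunction.mono {S T : Set ℝ} {φ φ₁ ψ ψ₁ ψ₂ : ℝ → ℝ} (hST : S ⊆ T)
    (h : EntropyFunction T φ φ₁ ψ ψ₁ ψ₂) : EntropyFunction S φ φ₁ ψ ψ₁ ψ₂ where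
  hasDerivAt_φ y hy := h.hasDerivAt_φ y (hST hy)
  hasDerivAt_φ₁ y hy := h.hasDerivAt_φ₁ y (hST hy)
  hasDerivAt_ψ y hy := h.hasDerivAt_ψ y (hST hy)
  hasDerivAt_ψ₁ y hy := h.hasDerivAt_ψ₁ y (hST hy)
  ψ_pos y hy := h.ψ_pos y (hST hy)
  ψ₁_nonpos y hy := h.ψ₁_nonpos y (hST hy)
  two_mul_sq_le y hy := h.two_mul_sq_le y (hST hy)
  tangent_le y hy z hz := h.tangent_le y (hST hy) z (hST hz)
  φ_tangent_le y hy z hz := h.φ_tangent_le y (hST hy) z (hST hz)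

lemma ContDiffOn.hasDerivAt_of_isOpen {S : Set ℝ} {F : ℝ → ℝ} (hF : ContDiffOn ℝ (⊤ : ℕ∞) F S)
    (hS : IsOpen S) {y : ℝ} (hy : y ∈ S) : HasDerivAt F (deriv F y) y :=
  ((hF.differentiableOn (by simp)).differentiableAt (hS.mem_nhds hy)).hasDerivAt

lemma entropyFunction_of_contDiffOn {S : Set ℝ} {φ : ℝ → ℝ} (hS : IsOpen S)
    (hconn : S.OrdConnected) (hφ : ContDiffOn ℝ (⊤ : ℕ∞) φ S)
    (hpos : ∀ x ∈ S, 0 < deriv (deriv φ) x) (hneg : ∀ x ∈ S, deriv (deriv (deriv φ)) x ≤ 0)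
    (hconv : ConvexOn ℝ S (fun x => -1 / deriv (deriv φ) x)) :
    EntropyFunction S φ (deriv φ) (deriv (deriv φ)) (deriv (deriv (deriv φ)))
      (deriv (deriv (deriv (deriv φ)))) := by
  have h1 : ContDiffOn ℝ (⊤ : ℕ∞) (deriv φ) S := hφ.deriv_of_isOpen hS (by simp)
  have h2 : ContDiffOn ℝ (⊤ : ℕ∞) (deriv (deriv φ)) S := h1.deriv_of_isOpen hS (by simp)
  have h3 : ContDiffOn ℝ (⊤ : ℕ∞) (deriv (deriv (deriv φ))) S := h2.deriv_of_isOpen hS (by simp)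
  have hF : ∀ y ∈ S, HasDerivAt (fun x => -1 / deriv (deriv φ) x)
      (deriv (deriv (deriv φ)) y / deriv (deriv φ) y ^ 2) y := fun y hy =>
    ((hasDerivAt_const y (-1 : ℝ)).fun_div (h2.hasDerivAt_of_isOpen hS hy)
      (hpos y hy).ne').congr_deriv (by ring)
  have hφc : ConvexOn ℝ S φ := by
    have hint : interior S = S := hS.interior_eq
    refine convexOn_of_deriv2_nonneg hconn.convex hφ.continuousOn ?_ ?_ ?_ <;> rw [hint]
    · exact hφ.differentiableOn (by simp)
    · exact h1.differentiableOn (by simp)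
    · exact fun x hx => (hpos x hx).le
  refine ⟨fun y hy => hφ.hasDerivAt_of_isOpen hS hy, fun y hy => h1.hasDerivAt_of_isOpen hS hy,
    fun y hy => h2.hasDerivAt_of_isOpen hS hy, fun y hy => h3.hasDerivAt_of_isOpen hS hy,
    hpos, hneg, fun y hy => ?_, fun y hy z hz g k => ?_, fun y hy z hz => ?_⟩
  · have h0 := hpos y hy
    have key := hconv.nonneg_of_hasDerivAt_of_hasDerivAt hS hy hF
      ((h3.hasDerivAt_of_isOpen hS hy).fun_div ((h2.hasDerivAt_of_isOpen hS hy).fun_pow 2)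
        (pow_pos h0 2).ne')
    generalize deriv (deriv (deriv (deriv φ))) y = s₂ at *
    generalize deriv (deriv (deriv φ)) y = s₁ at *
    generalize deriv (deriv φ) y = s at *
    have e : (s₂ * s ^ 2 - s₁ * (((2 : ℕ) : ℝ) * s ^ (2 - 1) * s₁)) / (s ^ 2) ^ 2
        = (s * s₂ - 2 * s₁ ^ 2) / s ^ 3 := by
      norm_num
      field_simp
    rw [e, le_div_iff₀ (by positivity)] at key
    linarith
  · have key := hconv.add_mul_sub_le_of_hasDerivAt hy hz (hF y hy)
    have hy0 := hpos y hy
    have hz0 := hpos z hz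
    generalize deriv (deriv (deriv φ)) y = s₁ at *
    generalize deriv (deriv φ) y = s at *
    generalize deriv (deriv φ) z = t at *
    have h4 := mul_le_mul_of_nonneg_left key (sq_nonneg (s * g))
    have e1 : (s * g) ^ 2 * (-1 / s + s₁ / s ^ 2 * (z - y)) = - s * g ^ 2 + s₁ * (z - y) * g ^ 2 := by
      field_simp
    have e2 : t * k ^ 2 = 2 * (s * g) * k + (s * g) ^ 2 * (-1 / t) + (t * k - s * g) ^ 2 / t := by
      field_simp; ring
    have h5 : 0 ≤ (t * k - s * g) ^ 2 / t := by positivity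
    rw [e1] at h4
    linarith
  · have := hφc.add_mul_sub_le_of_hasDerivAt hy hz (hφ.hasDerivAt_of_isOpen hS hy)
    linarith

end Entropy

section Global

variable {σ b : ℝ → ℝ} {U0 : ℝ}

lemma hasDerivAt_exp_neg_Upot (hσ : Continuous σ) (hb : Continuous b) (hpos : ∀ x, 0 < σ x)
    (x : ℝ) : HasDerivAt (fun x => Real.exp (-(Upot σ b U0 x)))
      (Real.exp (-(Upot σ b U0 x)) * (b x / σ x ^ 2)) x := by
  have hc : Continuous fun u => b u / σ u ^ 2 :=
    hb.div (hσ.pow 2) fun u => (pow_pos (hpos u) 2).ne'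
  have h : HasDerivAt (Upot σ b U0) (0 - b x / σ x ^ 2) x :=
    (hasDerivAt_const x U0).sub (hc.integral_hasStrictDerivAt 0 x).hasDerivAt
  exact h.fun_neg.exp.congr_deriv (by ring)

lemma continuous_density (hσ : Continuous σ) (hb : Continuous b) (hpos : ∀ x, 0 < σ x) :
    Continuous fun x => Real.exp (-(Upot σ b U0 x)) / σ x ^ 2 :=
  (continuous_iff_continuousAt.2 fun x =>
    (hasDerivAt_exp_neg_Upot hσ hb hpos x).continuousAt).div (hσ.pow 2)
      fun x => (pow_pos (hpos x) 2).ne'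

lemma tendsto_intervalIntegral_muMeas (hσ : Continuous σ) (hb : Continuous b)
    (hpos : ∀ x, 0 < σ x) {h : ℝ → ℝ} (hh : Integrable h (muMeas σ b U0)) :
    Tendsto (fun n : ℝ => ∫ x in (-n)..n, Real.exp (-(Upot σ b U0 x)) / σ x ^ 2 * h x) atTop
      (𝓝 (∫ x, h x ∂(muMeas σ b U0))) := by
  have hm : Measurable fun x => ENNReal.ofReal (Real.exp (-(Upot σ b U0 x)) / σ x ^ 2) :=
    (continuous_density hσ hb hpos).measurable.ennreal_ofReal
  have hlt : ∀ᵐ x ∂(volume : Measure ℝ),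
      ENNReal.ofReal (Real.exp (-(Upot σ b U0 x)) / σ x ^ 2) < ⊤ :=
    Eventually.of_forall fun x => ENNReal.ofReal_lt_top
  have e : (fun x => (ENNReal.ofReal (Real.exp (-(Upot σ b U0 x)) / σ x ^ 2)).toReal • h x)
      = fun x => Real.exp (-(Upot σ b U0 x)) / σ x ^ 2 * h x := by
    funext x
    rw [ENNReal.toReal_ofReal (div_nonneg (Real.exp_pos _).le (sq_nonneg _)), smul_eq_mul]
  rw [muMeas, integrable_withDensity_iff_integrable_smul' hm hlt, e] at hh
  rw [muMeas, integral_withDensity_eq_integral_toReal_smul hm hlt, e]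
  exact intervalIntegral_tendsto_integral hh tendsto_neg_atTop_atBot tendsto_id

end Global

section Line

variable {σ b a φ f : ℝ → ℝ} {U0 ρ : ℝ} {I : Set ℝ}

lemma exists_eq_outside_of_hasCompactSupport_deriv (hf : ContDiff ℝ (⊤ : ℕ∞) f)
    (hmono : Monotone f) (hsupp : HasCompactSupport (deriv f)) :
    ∃ R, (∀ x, f x ∈ Icc (f (-R)) (f R)) ∧ ∀ x, R < |x| → deriv f x = 0 := by
  obtain ⟨R, hR⟩ := hsupp.isCompact.isBounded.subset_closedBall 0
  have hz : ∀ x, R < |x| → deriv f x = 0 := fun x hx => by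
    by_contra hne
    have := hR (subset_tsupport _ hne)
    rw [mem_closedBall_zero_iff, Real.norm_eq_abs] at this
    linarith
  have hd := hf.differentiable (by simp)
  refine ⟨R, fun x => ⟨?_, ?_⟩, hz⟩
  · rcases le_total (-R) x with h | h
    · exact hmono h
    · refine (antitoneOn_of_deriv_nonpos (convex_Iic (-R)) hd.continuous.continuousOn
        hd.differentiableOn (fun y hy => ?_) h self_mem_Iic h)
      rw [interior_Iic, mem_Iio] at hy
      exact (hz y (by linarith [neg_le_abs y])).le
  · rcases le_total x R with h | h
    · exact hmono h
    · refine (antitoneOn_of_deriv_nonpos (convex_Ici R) hd.continuous.continuousOn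
        hd.differentiableOn (fun y hy => ?_) self_mem_Ici h h)
      rw [interior_Ici, mem_Ioi] at hy
      exact (hz y (by linarith [le_abs_self y])).le

/-- The restricted `φ`-entropy inequality on the line. -/
theorem phi_entropy_le (hσ : ContDiff ℝ (⊤ : ℕ∞) σ) (hb : ContDiff ℝ (⊤ : ℕ∞) b)
    (ha : ContDiff ℝ (⊤ : ℕ∞) a) (hσpos : ∀ x, 0 < σ x) (hapos : ∀ x, 0 < a x)
    (hprob : IsProbabilityMeasure (muMeas σ b U0)) (hI : IsOpen I) (hIconn : I.OrdConnected)
    (hφ : ContDiffOn ℝ (⊤ : ℕ∞) φ I) (hφ₂ : ∀ x ∈ I, 0 < deriv (deriv φ) x)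
    (hφ₃ : ∀ x ∈ I, deriv (deriv (deriv φ)) x ≤ 0)
    (hφconv : ConvexOn ℝ I (fun x => -1 / deriv (deriv φ) x))
    (hρ : 0 < ρ) (hVa : ∀ x, ρ ≤ potV σ b a x) (hf : ContDiff ℝ (⊤ : ℕ∞) f) (hfI : ∀ x, f x ∈ I)
    (hmono : Monotone f) (hsupp : HasCompactSupport (deriv f))
    (hdec : ∀ x, deriv (fun y => σ y / a y) x ≤ 0) :
    2 * ρ * ((∫ x, φ (f x) ∂(muMeas σ b U0)) - φ (∫ x, f x ∂(muMeas σ b U0)))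
      ≤ ∫ x, σ x ^ 2 * deriv (deriv φ) (f x) * deriv f x ^ 2 ∂(muMeas σ b U0) := by
  set μ := muMeas σ b U0 with hμ
  set p : ℝ → ℝ := fun x => Real.exp (-(Upot σ b U0 x)) with hp
  set w : ℝ → ℝ := fun x => Real.exp (-(Upot σ b U0 x)) / σ x ^ 2 with hw
  obtain ⟨R, hR, hz⟩ := exists_eq_outside_of_hasCompactSupport_deriv hf hmono hsupp
  have hIcc : Icc (f (-R)) (f R) ⊆ I := hIconn.out (hfI _) (hfI _)
  have hpd : ∀ x, HasDerivAt p (p x * (b x / σ x ^ 2)) x :=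
    hasDerivAt_exp_neg_Upot hσ.continuous hb.continuous hσpos
  have hc : DiffusionCoeffs ρ σ b a p w :=
    ⟨hσ, hb, ha, hσpos, hapos, fun x => Real.exp_pos _, hpd, fun x => rfl, hρ, hVa, hdec⟩
  have heI := entropyFunction_of_contDiffOn hI hIconn hφ hφ₂ hφ₃ hφconv
  have he := heI.mono hIcc
  have hf' : ContDiff ℝ (⊤ : ℕ∞) (deriv f) := hf.iterate_deriv 1
  have hf'' : ContDiff ℝ (⊤ : ℕ∞) (deriv (deriv f)) := hf.iterate_deriv 2
  have hlocal : ∀ n : ℝ, max R 0 < n → 2 * ρ * intervalEntropy (-n) n w φ f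
      ≤ ∫ x in (-n)..n, w x * (σ x ^ 2 * deriv (deriv φ) (f x) * deriv f x ^ 2) := by
    intro n hn
    obtain ⟨hRn, hn0⟩ := max_lt_iff.1 hn
    have hv : NeumannMonotone (-n) n (f (-R)) (f R) f (deriv f) :=
      ⟨hf.continuous.continuousOn, hf'.continuous.continuousOn,
        fun x _ => (hf.differentiable (by simp) x).hasDerivAt,
        hz _ (by rwa [abs_neg, abs_of_pos hn0]), hz _ (by rwa [abs_of_pos hn0]),
        fun x _ => hmono.deriv_nonneg, fun x _ => hR x⟩
    have key := intervalEntropy_le (by linarith) ((hR 0).1.trans (hR 0).2) hc he hv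
      (l := Lop σ b f) (fun x _ => ?_) ?_
    · refine key.trans_eq (intervalIntegral.integral_congr fun x _ => ?_)
      have := (hσpos x).ne'
      simp only [hw, hp]
      field_simp
    · refine ((hpd x).fun_mul (hf'.differentiable (by simp) x).hasDerivAt).congr_deriv ?_
      have := (hσpos x).ne'
      simp only [hw, hp, Lop]
      field_simp
      ring
    · exact (((hσ.continuous.pow 2).mul hf''.continuous).add
        (hb.continuous.mul hf'.continuous)).continuousOn
  have hcφ : Continuous fun x => φ (f x) :=
    hφ.continuousOn.comp_continuous hf.continuous hfI
  have hcψ : Continuous fun x => deriv (deriv φ) (f x) :=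
    he.continuousOn_ψ.comp_continuous hf.continuous hR
  have hif : Integrable f μ := by
    refine Integrable.of_bound hf.continuous.aestronglyMeasurable (max |f (-R)| |f R|)
      (Eventually.of_forall fun x => ?_)
    exact abs_le_max_abs_abs (hR x).1 (hR x).2
  have hiφ : Integrable (fun x => φ (f x)) μ := by
    obtain ⟨C, hC⟩ := isCompact_Icc.exists_bound_of_continuousOn he.continuousOn_φ
    exact Integrable.of_bound hcφ.aestronglyMeasurable C
      (Eventually.of_forall fun x => hC _ (hR x))
  have hiJ : Integrable (fun x => σ x ^ 2 * deriv (deriv φ) (f x) * deriv f x ^ 2) μ := by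
    refine Continuous.integrable_of_hasCompactSupport
      (((hσ.continuous.pow 2).mul hcψ).mul (hf'.continuous.pow 2)) ?_
    exact (hsupp.comp_left (g := fun t => t ^ 2) (by simp)).mul_left
  have tendsto_int {h : ℝ → ℝ} (hh : Integrable h μ) :
      Tendsto (fun n : ℝ => ∫ x in (-n)..n, w x * h x) atTop (𝓝 (∫ x, h x ∂μ)) :=
    tendsto_intervalIntegral_muMeas hσ.continuous hb.continuous hσpos hh
  have hW : Tendsto (fun n : ℝ => ∫ x in (-n)..n, w x) atTop (𝓝 1) := by
    simpa using tendsto_int (integrable_const (1 : ℝ))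
  have hmean : ∫ x, f x ∂μ ∈ I := by
    refine hIcc ⟨?_, ?_⟩
    · simpa using integral_mono (integrable_const (f (-R))) hif fun x => (hR x).1
    · simpa using integral_mono hif (integrable_const (f R)) fun x => (hR x).2
  have hratio : Tendsto (fun n : ℝ => (∫ x in (-n)..n, w x * f x) / ∫ x in (-n)..n, w x) atTop
      (𝓝 (∫ x, f x ∂μ)) := by
    have h := (tendsto_int hif).div hW one_ne_zero
    rwa [div_one] at h
  have hφmean := (heI.hasDerivAt_φ _ hmean).continuousAt.tendsto.comp hratio
  have hE : Tendsto (fun n : ℝ => 2 * ρ * intervalEntropy (-n) n w φ f) atTop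
      (𝓝 (2 * ρ * ((∫ x, φ (f x) ∂μ) - 1 * φ (∫ x, f x ∂μ)))) :=
    ((tendsto_int hiφ).sub (hW.mul hφmean)).const_mul _
  rw [one_mul] at hE
  refine le_of_tendsto_of_tendsto hE (tendsto_int hiJ) ?_
  filter_upwards [eventually_gt_atTop (max R 0)] with n hn using hlocal n hn

end Line

end Helpers

/-- Restricted φ-entropy inequality: for `φ` smooth on an open interval `I` with
`φ'' > 0`, `φ''' ≤ 0` and `−1/φ''` convex, if `m σ ≤ a ≤ M σ` and `V_a ≥ ρ > 0`, then for
every smooth increasing `I`-valued `f` with compactly supported derivative, provided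
`(σ/a)' ≤ 0`, one has `2ρ Ent_μ^φ(f) ≤ ∫ σ² φ''(f) (f')² dμ`. -/
theorem restricted_phi_entropy_inequality
    (σ b a : ℝ → ℝ) (U0 ρ m M : ℝ) (I : Set ℝ) (φ : ℝ → ℝ)
    (hσ : ContDiff ℝ (⊤ : ℕ∞) σ) (hb : ContDiff ℝ (⊤ : ℕ∞) b) (ha : ContDiff ℝ (⊤ : ℕ∞) a)
    (hσpos : ∀ x, 0 < σ x) (hapos : ∀ x, 0 < a x)
    (hcomp₁ : ∫⁻ u in Set.Ioi (0:ℝ), ENNReal.ofReal (1 / σ u) = ⊤)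
    (hcomp₂ : ∫⁻ u in Set.Iio (0:ℝ), ENNReal.ofReal (1 / σ u) = ⊤)
    (hprob : IsProbabilityMeasure (muMeas σ b U0))
    (hI : IsOpen I) (hIconn : I.OrdConnected)
    (hφ : ContDiffOn ℝ (⊤ : ℕ∞) φ I)
    (hφ'' : ∀ x ∈ I, 0 < deriv (deriv φ) x)
    (hφ''' : ∀ x ∈ I, deriv (deriv (deriv φ)) x ≤ 0)
    (hφconv : ConvexOn ℝ I (fun x => -1 / deriv (deriv φ) x))
    (hm : 0 < m) (hmM : m ≤ M)
    (hma : ∀ x, m * σ x ≤ a x) (haM : ∀ x, a x ≤ M * σ x)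
    (hρ : 0 < ρ) (hVa : ∀ x, ρ ≤ potV σ b a x) :
    ∀ f : ℝ → ℝ, ContDiff ℝ (⊤ : ℕ∞) f → (∀ x, f x ∈ I) → Monotone f →
      HasCompactSupport (deriv f) →
      (∀ x, deriv (fun y => σ y / a y) x ≤ 0) →
      2 * ρ * ((∫ x, φ (f x) ∂(muMeas σ b U0)) - φ (∫ x, f x ∂(muMeas σ b U0)))
        ≤ ∫ x, σ x ^ 2 * deriv (deriv φ) (f x) * deriv f x ^ 2 ∂(muMeas σ b U0) := by
  intro f hf hfI hmono hsupp hdec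
  exact phi_entropy_le hσ hb ha hσpos hapos hprob hI hIconn hφ hφ'' hφ''' hφconv hρ hVa hf hfI
    hmono hsupp hdec
end
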